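/- arXiv:1804.04895 — 4 statements merged into one kernel-verified Lean document; each statement's English description precedes it below -/
import Mathlib

section
/- Let n ≥ 1 and let ω be a non-empty open subset of ℝⁿ. Then there exists a constant C = C(ω) > 1 such that for all N ∈ ℕ and all f ∈ E_N, one has ‖f‖_{L²(ℝⁿ)} ≤ C · e^{(1/2) N ln(N+1) + C N} · ‖f‖_{L²(ω)}. -/
open MeasureTheory

noncomputable section

/-- The one-dimensional Hermite functions
`φ_k(x) = ((-1)^k / √(2^k k! √π)) e^{x²/2} (d/dx)^k e^{-x²}`. -/
def hermiteFn (k : ℕ) (x : ℝ) : ℝ :=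
  ((-1 : ℝ) ^ k / Real.sqrt (2 ^ k * Nat.factorial k * Real.sqrt Real.pi)) *
    Real.exp (x ^ 2 / 2) * iteratedDeriv k (fun y => Real.exp (-(y ^ 2))) x

/-- The `n`-dimensional Hermite functions `Φ_α(x) = ∏_j φ_{α_j}(x_j)`, viewed as
complex-valued functions. -/
def hermitePhi {n : ℕ} (α : Fin n → ℕ) (x : EuclideanSpace ℝ (Fin n)) : ℂ :=
  ∏ j, (hermiteFn (α j) (x j) : ℂ)

/-- `E_N`, the span of the Hermite functions `Φ_α` with `|α| ≤ N`. -/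
def hermiteSpan (n N : ℕ) : Submodule ℂ (EuclideanSpace ℝ (Fin n) → ℂ) :=
  Submodule.span ℂ {f | ∃ α : Fin n → ℕ, (∑ j, α j) ≤ N ∧ f = hermitePhi α}

end

open Polynomial in
lemma aux_prod_abs (i : ℕ) : ∀ k : ℕ,
    ∏ j ∈ (Finset.range (i + k + 1)).erase i, |(i : ℝ) - j| = (i.factorial * k.factorial : ℝ) := by
  intro k
  induction k with
  | zero =>
    have : (Finset.range (i + 0 + 1)).erase i = Finset.range i := by
      ext j; simp; omega
    rw [this]
    have h2 : ∏ j ∈ Finset.range i, |(i : ℝ) - j| = ∏ j ∈ Finset.range i, ((i - 1 - j : ℕ) + 1 : ℝ) := by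
      apply Finset.prod_congr rfl
      intro j hj
      have hj := Finset.mem_range.mp hj
      have : ((i - 1 - j : ℕ) + 1 : ℝ) = (i : ℝ) - j := by
        have h : i - 1 - j + 1 + j = i := by omega
        have h' : ((i - 1 - j : ℕ) + 1 + j : ℝ) = i := by exact_mod_cast h
        linarith
      rw [this, abs_of_nonneg]
      have : (j : ℝ) ≤ i := by exact_mod_cast hj.le
      linarith
    rw [h2, Finset.prod_range_reflect (fun m => ((m : ℕ) + 1 : ℝ)) i]
    have := Finset.prod_range_add_one_eq_factorial i
    simp
    exact_mod_cast this
  | succ k ih =>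
    have : (Finset.range (i + (k + 1) + 1)).erase i
        = insert (i + k + 1) ((Finset.range (i + k + 1)).erase i) := by
      ext j; simp; omega
    rw [this, Finset.prod_insert (by simp), ih, Nat.factorial_succ]
    have : |(i : ℝ) - ((i + k + 1 : ℕ) : ℝ)| = (k : ℝ) + 1 := by
      push_cast
      rw [show (i : ℝ) - (i + k + 1) = -(k + 1) by ring, abs_neg, abs_of_nonneg (by positivity)]
    rw [this]
    push_cast
    ring

open Polynomial in
lemma aux_lagrange (N : ℕ) (η : ℝ) (hη : 0 < η) (hη1 : η ≤ 1) :
    ∃ (s : ℕ → ℝ) (c : ℕ → ℂ), (∀ i ∈ Finset.range (N + 1), 1 ≤ s i ∧ s i ≤ 1 + η) ∧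
      (∀ q : ℂ[X], q.natDegree ≤ N →
        q.eval 0 = ∑ i ∈ Finset.range (N + 1), c i * q.eval (s i : ℂ)) ∧
      ∑ i ∈ Finset.range (N + 1), ‖c i‖ ≤ Real.exp 1 * (4 * Real.exp 1 / η) ^ N := by
  set s : ℕ → ℝ := fun i => 1 + η * (i / (N + 1)) with hs
  have hN : (0 : ℝ) < N + 1 := by positivity
  have hsb : ∀ i ∈ Finset.range (N + 1), 1 ≤ s i ∧ s i ≤ 1 + η := by
    intro i hi
    have hi' : (i : ℝ) ≤ N + 1 := by exact_mod_cast (Finset.mem_range.mp hi).le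
    have h1 : (i : ℝ) / (N + 1) ≤ 1 := by rw [div_le_one hN]; exact hi'
    have h0 : 0 ≤ (i : ℝ) / (N + 1) := by positivity
    simp only [hs]
    constructor <;> nlinarith
  have hdiff : ∀ i j : ℕ, s i - s j = η / (N + 1) * ((i : ℝ) - j) := by
    intro i j; simp only [hs]; field_simp; ring
  have hinj : Set.InjOn (fun i => (s i : ℂ)) (Finset.range (N + 1) : Set ℕ) := by
    intro i _ j _ h
    have h' : s i = s j := Complex.ofReal_injective h
    have h2 : s i - s j = 0 := by linarith
    rw [hdiff, mul_eq_zero] at h2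
    rcases h2 with h2 | h2
    · have : 0 < η / (N + 1) := by positivity
      linarith
    · have : (i : ℝ) = j := by linarith
      exact_mod_cast this
  refine ⟨s, fun i => (Lagrange.basis (Finset.range (N + 1)) (fun i => (s i : ℂ)) i).eval 0,
    hsb, ?_, ?_⟩
  · intro q hq
    have hd : q.degree < (Finset.range (N + 1)).card := by
      rw [Finset.card_range]
      exact lt_of_le_of_lt degree_le_natDegree (by exact_mod_cast Nat.lt_succ_of_le hq)
    conv_lhs => rw [Lagrange.eq_interpolate hinj hd]
    rw [Lagrange.interpolate_apply, eval_finsetSum]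
    apply Finset.sum_congr rfl
    intro i _
    rw [eval_mul, eval_C, mul_comm]
  · have hb : ∀ i ∈ Finset.range (N + 1),
        ‖(Lagrange.basis (Finset.range (N + 1)) (fun i => (s i : ℂ)) i).eval 0‖
          ≤ (2 * (N + 1) / η) ^ N * (N.choose i / N.factorial) := by
      intro i hi
      have hiN : i ≤ N := Nat.lt_succ_iff.mp (Finset.mem_range.mp hi)
      rw [Lagrange.basis, eval_prod, norm_prod]
      have h1 : ∀ j ∈ (Finset.range (N + 1)).erase i,
          ‖eval 0 (Lagrange.basisDivisor (s i : ℂ) (s j : ℂ))‖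
            ≤ (2 * (N + 1) / η) * |(i : ℝ) - j|⁻¹ := by
        intro j hj
        have hj' := hsb j (Finset.mem_of_mem_erase hj)
        rw [Lagrange.basisDivisor]
        simp only [eval_mul, eval_C, eval_sub, eval_X, zero_sub, norm_mul, norm_inv, norm_neg]
        rw [← Complex.ofReal_sub, Complex.norm_real, Complex.norm_real, Real.norm_eq_abs,
          Real.norm_eq_abs, hdiff, abs_mul, abs_of_pos (by positivity : 0 < η / ((N : ℝ) + 1)),
          abs_of_nonneg (by linarith : 0 ≤ s j), mul_inv, inv_div]
        have : s j ≤ 2 := by linarith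
        have h0 : 0 ≤ ((N : ℝ) + 1) / η * |(i : ℝ) - j|⁻¹ := by positivity
        calc _ ≤ ((N : ℝ) + 1) / η * |(i : ℝ) - j|⁻¹ * 2 := by gcongr
          _ = _ := by ring
      refine (Finset.prod_le_prod (fun _ _ => norm_nonneg _) h1).trans (le_of_eq ?_)
      rw [Finset.prod_mul_distrib, Finset.prod_const, Finset.card_erase_of_mem hi,
        Finset.card_range, Nat.add_sub_cancel, Finset.prod_inv_distrib]
      obtain ⟨k, rfl⟩ := Nat.exists_eq_add_of_le hiN
      rw [aux_prod_abs, Nat.choose_symm_add, Nat.add_choose, Nat.cast_div (Nat.factorial_mul_factorial_dvd_factorial_add i k) (by positivity)]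
      push_cast
      field_simp
    refine (Finset.sum_le_sum hb).trans ?_
    rw [← Finset.mul_sum, ← Finset.sum_div]
    have hc : ∑ i ∈ Finset.range (N + 1), (N.choose i : ℝ) = 2 ^ N := by
      exact_mod_cast Nat.sum_range_choose N
    rw [hc]
    have he := Real.pow_div_factorial_le_exp (x := (N : ℝ) + 1) (by positivity) N
    calc (2 * ((N : ℝ) + 1) / η) ^ N * (2 ^ N / N.factorial)
        = (4 / η) ^ N * (((N : ℝ) + 1) ^ N / N.factorial) := by
          rw [show (4 : ℝ) = 2 * 2 by norm_num]
          simp only [div_pow, mul_pow]; ring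
      _ ≤ (4 / η) ^ N * Real.exp (N + 1) := by gcongr
      _ = _ := by
          rw [Real.exp_add, ← Real.exp_one_pow N]
          simp only [div_pow, mul_pow]; ring

/-- Continuous functions whose restriction to every line is a polynomial of degree at most `N`. -/
def LinePoly {n : ℕ} (N : ℕ) (P : EuclideanSpace ℝ (Fin n) → ℂ) : Prop :=
  Continuous P ∧ ∀ x v, ∃ q : Polynomial ℂ, q.natDegree ≤ N ∧ ∀ t : ℝ, P (x + t • v) = q.eval (t : ℂ)

lemma aux_iter (k : ℕ) : ∃ H : Polynomial ℝ, H.natDegree ≤ k ∧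
    iteratedDeriv k (fun y : ℝ => Real.exp (-(y ^ 2))) = fun x => H.eval x * Real.exp (-(x ^ 2)) := by
  induction k with
  | zero => exact ⟨1, by simp, by simp⟩
  | succ k ih =>
    obtain ⟨H, hH, hd⟩ := ih
    refine ⟨Polynomial.derivative H - 2 * Polynomial.X * H, ?_, ?_⟩
    · refine (Polynomial.natDegree_sub_le _ _).trans (max_le ?_ ?_)
      · exact (Polynomial.natDegree_derivative_le H).trans (by omega)
      · have h2 : (2 * Polynomial.X : Polynomial ℝ).natDegree ≤ 1 := by compute_degree
        exact Polynomial.natDegree_mul_le.trans (by omega)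
    · rw [iteratedDeriv_succ, hd]
      funext x
      have h1 : HasDerivAt (fun x : ℝ => Real.exp (-(x ^ 2)))
          (Real.exp (-(x ^ 2)) * (-(2 * x))) x := by
        have := ((hasDerivAt_pow 2 x).neg).exp
        simpa using this
      have := ((H.hasDerivAt x).mul h1).deriv
      refine Eq.trans this ?_
      simp
      ring

lemma aux_hermiteFn (k : ℕ) : ∃ H : Polynomial ℝ, H.natDegree ≤ k ∧
    ∀ x, hermiteFn k x = H.eval x * Real.exp (-(x ^ 2) / 2) := by
  obtain ⟨H, hH, hd⟩ := aux_iter k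
  refine ⟨Polynomial.C ((-1 : ℝ) ^ k / Real.sqrt (2 ^ k * Nat.factorial k * Real.sqrt Real.pi)) * H,
    (Polynomial.natDegree_C_mul_le _ _).trans hH, fun x => ?_⟩
  have : Real.exp (-(x ^ 2) / 2) = Real.exp (x ^ 2 / 2) * Real.exp (-(x ^ 2)) := by
    rw [← Real.exp_add]; congr 1; ring
  rw [hermiteFn, hd, this]
  simp
  ring

open Polynomial in
lemma aux_phi {n : ℕ} (α : Fin n → ℕ) (N : ℕ) (h : ∑ j, α j ≤ N) :
    ∃ P, LinePoly N P ∧ ∀ x, hermitePhi α x = P x * (Real.exp (-(‖x‖ ^ 2) / 2) : ℂ) := by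
  choose H hH hx using fun j => aux_hermiteFn (α j)
  refine ⟨fun x => ∏ j, (((H j).eval (x j) : ℝ) : ℂ), ⟨?_, ?_⟩, ?_⟩
  · fun_prop
  · intro x v
    refine ⟨∏ j, (((H j).comp (C (x j) + C (v j) * X)).map Complex.ofRealHom), ?_, ?_⟩
    · refine (natDegree_prod_le _ _).trans (le_trans (Finset.sum_le_sum fun j _ => ?_) h)
      refine natDegree_map_le.trans (natDegree_comp_le.trans ?_)
      have : (C (x j) + C (v j) * X).natDegree ≤ 1 := by compute_degree
      calc _ ≤ α j * 1 := Nat.mul_le_mul (hH j) this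
        _ = α j := by simp
    · intro t
      rw [eval_prod]
      apply Finset.prod_congr rfl
      intro j _
      have : (t : ℂ) = Complex.ofRealHom t := rfl
      rw [this, eval_map_apply]
      simp
      ring_nf
  · intro x
    simp only [hermitePhi, hx]
    push_cast
    rw [Finset.prod_mul_distrib]
    congr 1
    rw [← Complex.exp_sum]
    congr 1
    rw [← Complex.ofReal_pow, EuclideanSpace.norm_sq_eq]
    rw [Complex.ofReal_sum, ← Finset.sum_neg_distrib, Finset.sum_div]
    simp

lemma aux_span {n : ℕ} (N : ℕ) (f) (hf : f ∈ hermiteSpan n N) :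
    ∃ P, LinePoly N P ∧ ∀ x, f x = P x * (Real.exp (-(‖x‖ ^ 2) / 2) : ℂ) := by
  induction hf using Submodule.span_induction with
  | mem f h =>
    obtain ⟨α, hα, rfl⟩ := h
    exact aux_phi α N hα
  | zero => exact ⟨fun _ => 0, ⟨continuous_const, fun _ _ => ⟨0, by simp, by simp⟩⟩, by simp⟩
  | add f g _ _ hf hg =>
    obtain ⟨P, ⟨hPc, hP⟩, hfP⟩ := hf
    obtain ⟨Q, ⟨hQc, hQ⟩, hgQ⟩ := hg
    refine ⟨fun x => P x + Q x, ⟨hPc.add hQc, fun x v => ?_⟩, fun x => ?_⟩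
    · obtain ⟨p, hp, hp'⟩ := hP x v
      obtain ⟨q, hq, hq'⟩ := hQ x v
      exact ⟨p + q, (Polynomial.natDegree_add_le _ _).trans (max_le hp hq), fun t => by simp [hp', hq']⟩
    · simp [hfP, hgQ, add_mul]
  | smul a f _ hf =>
    obtain ⟨P, ⟨hPc, hP⟩, hfP⟩ := hf
    refine ⟨fun x => a * P x, ⟨continuous_const.mul hPc, fun x v => ?_⟩, fun x => ?_⟩
    · obtain ⟨p, hp, hp'⟩ := hP x v
      exact ⟨Polynomial.C a * p, (Polynomial.natDegree_C_mul_le _ _).trans hp, fun t => by simp [hp']⟩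
    · simp [hfP, mul_assoc]

lemma aux_growth {n : ℕ} (N : ℕ) (P : EuclideanSpace ℝ (Fin n) → ℂ) (hP : LinePoly N P)
    (x0 : EuclideanSpace ℝ (Fin n)) (r : ℝ) (hr : 0 < r) (x : EuclideanSpace ℝ (Fin n)) :
    volume.real (Metric.closedBall x0 r) * ‖P x‖ ≤
      Real.exp 1 * (4 * Real.exp 1 * (1 + ‖x - x0‖ / r)) ^ N *
        ∫ y in Metric.closedBall x0 (2 * r), ‖P y‖ := by
  obtain ⟨hPc, hP⟩ := hP
  set η : ℝ := r / (r + ‖x - x0‖) with hη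
  have hd : 0 < r + ‖x - x0‖ := by positivity
  have hη0 : 0 < η := by positivity
  have hη1 : η ≤ 1 := by rw [hη, div_le_one hd]; linarith [norm_nonneg (x - x0)]
  obtain ⟨s, c, hs, hq, hc⟩ := aux_lagrange N η hη0 hη1
  have hηinv : 4 * Real.exp 1 / η = 4 * Real.exp 1 * (1 + ‖x - x0‖ / r) := by
    rw [hη]; field_simp
  rw [hηinv] at hc
  set h : EuclideanSpace ℝ (Fin n) → ℝ :=
    (Metric.closedBall x0 (2 * r)).indicator (fun y => ‖P y‖) with hh
  have hmeas : MeasurableSet (Metric.closedBall x0 (2 * r)) := Metric.isClosed_closedBall.measurableSet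
  have hint : Integrable h := by
    rw [hh, integrable_indicator_iff hmeas]
    exact hPc.norm.continuousOn.integrableOn_compact (isCompact_closedBall _ _)
  have hh0 : ∀ y, 0 ≤ h y := fun y => Set.indicator_nonneg (fun _ _ => norm_nonneg _) y
  have hI : ∫ y in Metric.closedBall x0 (2 * r), ‖P y‖ = ∫ y, h y := by
    rw [hh, integral_indicator hmeas]
  have hI0 : 0 ≤ ∫ y, h y := integral_nonneg hh0
  have hpt : ∀ w, (Metric.closedBall x0 r).indicator (fun _ => ‖P x‖) w ≤
      ∑ i ∈ Finset.range (N + 1), ‖c i‖ * h ((1 - s i) • x + s i • w) := by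
    intro w
    by_cases hw : w ∈ Metric.closedBall x0 r
    · rw [Set.indicator_of_mem hw]
      obtain ⟨q, hqd, hqe⟩ := hP x (w - x)
      have h0 : P x = q.eval 0 := by simpa using hqe 0
      rw [h0, hq q hqd]
      refine (norm_sum_le _ _).trans (Finset.sum_le_sum fun i hi => ?_)
      rw [norm_mul, ← hqe]
      have hx : x + s i • (w - x) = (1 - s i) • x + s i • w := by
        simp only [smul_sub, sub_smul, one_smul]; abel
      rw [hx]
      have hmem : (1 - s i) • x + s i • w ∈ Metric.closedBall x0 (2 * r) := by
        rw [mem_closedBall_iff_norm]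
        rw [mem_closedBall_iff_norm] at hw
        have e : (1 - s i) • x + s i • w - x0 = (w - x0) + (s i - 1) • ((w - x0) - (x - x0)) := by
          simp only [smul_sub, sub_smul, one_smul]; abel
        rw [e]
        have h1 := hs i hi
        have hηd : η * (r + ‖x - x0‖) = r := by rw [hη]; field_simp
        calc _ ≤ ‖w - x0‖ + ‖(s i - 1) • ((w - x0) - (x - x0))‖ := norm_add_le _ _
          _ ≤ r + η * (r + ‖x - x0‖) := by
            rw [norm_smul, Real.norm_eq_abs, abs_of_nonneg (by linarith)]
            have := norm_sub_le (w - x0) (x - x0)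
            have h3 : s i - 1 ≤ η := by linarith
            gcongr
            linarith
          _ = 2 * r := by rw [hηd]; ring
      rw [hh, Set.indicator_of_mem hmem]
    · rw [Set.indicator_of_notMem hw]
      exact Finset.sum_nonneg fun i _ => mul_nonneg (norm_nonneg _) (hh0 _)
  have hcomp : ∀ i ∈ Finset.range (N + 1),
      Integrable (fun w => h ((1 - s i) • x + s i • w)) := by
    intro i hi
    have h1 : s i ≠ 0 := by linarith [(hs i hi).1]
    exact (hint.comp_add_left ((1 - s i) • x)).comp_smul h1
  have hcv : ∀ i ∈ Finset.range (N + 1),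
      ∫ w, h ((1 - s i) • x + s i • w) ≤ ∫ y, h y := by
    intro i hi
    have h1 := (hs i hi).1
    rw [Measure.integral_comp_smul_of_nonneg volume (fun y => h ((1 - s i) • x + y)) (s i)
      (hR := by linarith), integral_add_left_eq_self h]
    rw [smul_eq_mul]
    exact mul_le_of_le_one_left hI0 (inv_le_one_of_one_le₀ (one_le_pow₀ h1))
  have hL : ∫ w, (Metric.closedBall x0 r).indicator (fun _ => ‖P x‖) w =
      volume.real (Metric.closedBall x0 r) * ‖P x‖ := by
    rw [integral_indicator Metric.isClosed_closedBall.measurableSet]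
    simp
  rw [← hL, hI]
  have hci : ∀ i ∈ Finset.range (N + 1),
      Integrable (fun w => ‖c i‖ * h ((1 - s i) • x + s i • w)) :=
    fun i hi => (hcomp i hi).const_mul _
  calc _ ≤ ∫ w, ∑ i ∈ Finset.range (N + 1), ‖c i‖ * h ((1 - s i) • x + s i • w) := by
        refine integral_mono_of_nonneg (ae_of_all _ fun w =>
          Set.indicator_nonneg (fun _ _ => norm_nonneg _) w) (integrable_finsetSum _ hci)
          (ae_of_all _ hpt)
    _ = ∑ i ∈ Finset.range (N + 1), ‖c i‖ * ∫ w, h ((1 - s i) • x + s i • w) := by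
        rw [integral_finsetSum _ hci]
        simp only [integral_const_mul]
    _ ≤ ∑ i ∈ Finset.range (N + 1), ‖c i‖ * ∫ y, h y := by
        refine Finset.sum_le_sum fun i hi => ?_
        have := hcv i hi
        gcongr
    _ ≤ _ := by
        rw [← Finset.sum_mul]
        gcongr

lemma aux_cs {n : ℕ} (g : EuclideanSpace ℝ (Fin n) → ℝ) (hg : Continuous g)
    (x0 : EuclideanSpace ℝ (Fin n)) (r : ℝ) (hr : 0 < r) :
    (∫ y in Metric.closedBall x0 r, g y) ^ 2 ≤
      volume.real (Metric.closedBall x0 r) * ∫ y in Metric.closedBall x0 r, g y ^ 2 := by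
  set B := Metric.closedBall x0 r
  set V := volume.real B with hV
  have hVpos : 0 < V := by
    rw [hV]
    exact ENNReal.toReal_pos (Metric.measure_closedBall_pos volume x0 hr).ne'
      (isCompact_closedBall _ _).measure_lt_top.ne
  have i1 : IntegrableOn g B := hg.continuousOn.integrableOn_compact (isCompact_closedBall _ _)
  have i2 : IntegrableOn (fun y => g y ^ 2) B :=
    (hg.pow 2).continuousOn.integrableOn_compact (isCompact_closedBall _ _)
  set A := ∫ y in B, g y
  set J := ∫ y in B, g y ^ 2
  have i3 : IntegrableOn (fun _ : EuclideanSpace ℝ (Fin n) => (A / V) ^ 2) B :=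
    continuous_const.continuousOn.integrableOn_compact (isCompact_closedBall _ _)
  have key : 0 ≤ ∫ y in B, ((A / V) ^ 2 - 2 * (A / V) * g y + g y ^ 2) :=
    integral_nonneg fun y => by
      have := sq_nonneg (A / V - g y)
      simp only [Pi.zero_apply]
      linarith [this, sub_sq (A / V) (g y)]
  have i4 : IntegrableOn (fun y => (A / V) ^ 2 - 2 * (A / V) * g y) B := i3.sub (i1.const_mul _)
  rw [integral_add i4 i2, integral_sub i3 (i1.const_mul _),
    integral_const_mul] at key
  simp only [integral_const, measureReal_restrict_apply_univ, smul_eq_mul] at key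
  change 0 ≤ V * (A / V) ^ 2 - 2 * (A / V) * A + J at key
  have e : V * (A / V) ^ 2 - 2 * (A / V) * A = - (A ^ 2 / V) := by field_simp; ring
  rw [e] at key
  have : A ^ 2 / V ≤ J := by linarith
  rw [div_le_iff₀ hVpos] at this
  linarith

lemma aux_gauss (n : ℕ) : Integrable (fun x : EuclideanSpace ℝ (Fin n) => Real.exp (-(‖x‖ ^ 2) / 2)) := by
  have := (GaussianFourier.integrable_cexp_neg_mul_sq_norm_add_of_euclideanSpace (ι := Fin n)
    (b := 1 / 2) (by norm_num) 0 0).norm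
  refine this.congr (ae_of_all _ fun x => ?_)
  simp only [Complex.norm_exp]
  congr 1
  have : (-(1 / 2 : ℂ) * (‖x‖ : ℂ) ^ 2 + 0 * ((inner ℝ (0 : EuclideanSpace ℝ (Fin n)) x : ℝ) : ℂ))
    = ((-(‖x‖ ^ 2) / 2 : ℝ) : ℂ) := by push_cast; ring
  rw [this, Complex.ofReal_re]

lemma aux_pow (N : ℕ) (t : ℝ) :
    (1 + t) ^ (2 * N) ≤ 4 ^ N * N.factorial * (Real.exp (1 / 2) * Real.exp (t ^ 2 / 2)) := by
  have h1 : (1 + t) ^ 2 ≤ 4 * ((1 + t ^ 2) / 2) := by nlinarith [sq_nonneg (1 - t)]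
  have h2 := Real.pow_div_factorial_le_exp (x := (1 + t ^ 2) / 2) (by positivity) N
  rw [div_le_iff₀ (by positivity)] at h2
  rw [← Real.exp_add, ← add_div, pow_mul]
  calc ((1 + t) ^ 2) ^ N ≤ (4 * ((1 + t ^ 2) / 2)) ^ N := by gcongr
    _ = 4 ^ N * ((1 + t ^ 2) / 2) ^ N := by rw [mul_pow]
    _ ≤ 4 ^ N * (Real.exp ((1 + t ^ 2) / 2) * N.factorial) := by gcongr
    _ = _ := by ring

lemma aux_main (n : ℕ) (x0 : EuclideanSpace ℝ (Fin n)) (r : ℝ) (hr : 0 < r) :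
    ∃ K1 K2 : ℝ, 0 ≤ K1 ∧ 0 ≤ K2 ∧ ∀ N : ℕ, ∀ f ∈ hermiteSpan n N, Continuous f ∧ ∀ x,
      ‖f x‖ ^ 2 ≤ K1 * K2 ^ N * N.factorial *
        (∫ y in Metric.closedBall x0 (2 * r), ‖f y‖ ^ 2) * Real.exp (-(‖x‖ ^ 2) / 2) := by
  set V := volume.real (Metric.closedBall x0 r) with hV
  set W := volume.real (Metric.closedBall x0 (2 * r)) with hW
  have hVpos : 0 < V := by
    rw [hV]
    exact ENNReal.toReal_pos (Metric.measure_closedBall_pos volume x0 hr).ne'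
      (isCompact_closedBall _ _).measure_lt_top.ne
  have hW0 : 0 ≤ W := measureReal_nonneg
  set D := Real.exp ((‖x0‖ + 2 * r) ^ 2) with hD
  set A := 1 + (1 + ‖x0‖) / r with hA
  set F := 4 * Real.exp 1 * A with hF
  have hA0 : 0 < A := by positivity
  refine ⟨Real.exp 1 ^ 2 * W * D * Real.exp (1 / 2) / V ^ 2, 4 * F ^ 2, by positivity,
    by positivity, ?_⟩
  intro N f hf
  obtain ⟨P, hP, hfP⟩ := aux_span N f hf
  have hPc := hP.1
  have hfeq : f = fun x => P x * (Real.exp (-(‖x‖ ^ 2) / 2) : ℂ) := funext hfP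
  have hfc : Continuous f := by rw [hfeq]; fun_prop
  refine ⟨hfc, fun x => ?_⟩
  set J := ∫ y in Metric.closedBall x0 (2 * r), ‖f y‖ ^ 2 with hJ
  have hJ0 : 0 ≤ J := integral_nonneg fun y => by positivity
  have hfn : ∀ y, ‖f y‖ ^ 2 = ‖P y‖ ^ 2 * Real.exp (-(‖y‖ ^ 2)) := by
    intro y
    rw [hfP, norm_mul, Complex.norm_real, Real.norm_eq_abs, abs_of_pos (Real.exp_pos _), mul_pow,
      ← Real.exp_nat_mul]
    congr 2; push_cast; ring
  have hPJ : ∫ y in Metric.closedBall x0 (2 * r), ‖P y‖ ^ 2 ≤ D * J := by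
    rw [hJ, ← integral_const_mul]
    refine setIntegral_mono_on
      ((hPc.norm.pow 2).continuousOn.integrableOn_compact (isCompact_closedBall _ _))
      ((continuous_const.mul (hfc.norm.pow 2)).continuousOn.integrableOn_compact
        (isCompact_closedBall _ _)) Metric.isClosed_closedBall.measurableSet ?_
    intro y hy
    rw [hfn]
    have hy' : ‖y‖ ≤ ‖x0‖ + 2 * r := by
      rw [mem_closedBall_iff_norm] at hy
      have := norm_add_le (y - x0) x0
      rw [sub_add_cancel] at this
      linarith
    have : 1 ≤ D * Real.exp (-(‖y‖ ^ 2)) := by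
      rw [hD, ← Real.exp_add]
      apply Real.one_le_exp
      have : ‖y‖ ^ 2 ≤ (‖x0‖ + 2 * r) ^ 2 := by gcongr
      linarith
    calc ‖P y‖ ^ 2 = ‖P y‖ ^ 2 * 1 := by ring
      _ ≤ ‖P y‖ ^ 2 * (D * Real.exp (-(‖y‖ ^ 2))) := by gcongr
      _ = _ := by ring
  have hg := aux_growth N P hP x0 r hr x
  have hcs := aux_cs (fun y => ‖P y‖) hPc.norm x0 (2 * r) (by positivity)
  have hL1 : 0 ≤ ∫ y in Metric.closedBall x0 (2 * r), ‖P y‖ := integral_nonneg fun y => norm_nonneg _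
  have hAx : 1 + ‖x - x0‖ / r ≤ A * (1 + ‖x‖) := by
    have h1 := norm_sub_le x x0
    have h2 : ‖x - x0‖ / r ≤ (‖x‖ + ‖x0‖) / r := by gcongr
    have h3 : A * (1 + ‖x‖) = 1 + (‖x‖ + ‖x0‖) / r + (‖x‖ + (1 + ‖x0‖ * ‖x‖) / r) := by
      rw [hA]; field_simp; ring
    have h4 : 0 ≤ ‖x‖ + (1 + ‖x0‖ * ‖x‖) / r := by positivity
    linarith
  have hg2 : V * ‖P x‖ ≤ Real.exp 1 * (F * (1 + ‖x‖)) ^ N *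
      ∫ y in Metric.closedBall x0 (2 * r), ‖P y‖ := by
    refine hg.trans ?_
    have : 4 * Real.exp 1 * (1 + ‖x - x0‖ / r) ≤ F * (1 + ‖x‖) := by
      rw [hF, mul_assoc _ A]
      gcongr
    gcongr
  have hg3 : V ^ 2 * ‖P x‖ ^ 2 ≤ Real.exp 1 ^ 2 * (F ^ 2) ^ N * (1 + ‖x‖) ^ (2 * N) * (W * (D * J)) := by
    calc V ^ 2 * ‖P x‖ ^ 2 = (V * ‖P x‖) ^ 2 := by ring
      _ ≤ (Real.exp 1 * (F * (1 + ‖x‖)) ^ N *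
          ∫ y in Metric.closedBall x0 (2 * r), ‖P y‖) ^ 2 := by gcongr
      _ = Real.exp 1 ^ 2 * (F ^ 2) ^ N * (1 + ‖x‖) ^ (2 * N) *
          (∫ y in Metric.closedBall x0 (2 * r), ‖P y‖) ^ 2 := by
        rw [pow_mul' (1 + ‖x‖)]
        simp only [mul_pow, ← pow_mul]
        ring
      _ ≤ _ := by
        gcongr
        refine hcs.trans ?_
        gcongr
  have hsplit : Real.exp (-(‖x‖ ^ 2)) * Real.exp (‖x‖ ^ 2 / 2) = Real.exp (-(‖x‖ ^ 2) / 2) := by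
    rw [← Real.exp_add]; congr 1; ring
  rw [hfn]
  have hP2 : ‖P x‖ ^ 2 ≤ Real.exp 1 ^ 2 * (F ^ 2) ^ N * (4 ^ N * N.factorial *
      (Real.exp (1 / 2) * Real.exp (‖x‖ ^ 2 / 2))) * (W * (D * J)) / V ^ 2 := by
    rw [le_div_iff₀ (by positivity), mul_comm]
    refine hg3.trans ?_
    have := aux_pow N ‖x‖
    gcongr
  calc _ ≤ Real.exp 1 ^ 2 * (F ^ 2) ^ N * (4 ^ N * N.factorial *
      (Real.exp (1 / 2) * Real.exp (‖x‖ ^ 2 / 2))) * (W * (D * J)) / V ^ 2 *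
        Real.exp (-(‖x‖ ^ 2)) := by gcongr
    _ = Real.exp 1 ^ 2 * W * D * Real.exp (1 / 2) / V ^ 2 * (4 * F ^ 2) ^ N * N.factorial * J *
        (Real.exp (-(‖x‖ ^ 2)) * Real.exp (‖x‖ ^ 2 / 2)) := by
      rw [mul_pow 4 (F ^ 2)]; ring
    _ = _ := by rw [hsplit]

/-- **Spectral inequality for non-empty open control subsets.**
If `ω` is a non-empty open subset of `ℝⁿ` (`n ≥ 1`), then there exists `C = C(ω) > 1` such
that for all `N ∈ ℕ` and all `f ∈ E_N`,
`‖f‖_{L²(ℝⁿ)} ≤ C e^{(1/2) N ln(N+1) + C N} ‖f‖_{L²(ω)}`. -/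
theorem spectral_inequality_open (n : ℕ) (hn : 1 ≤ n)
    (ω : Set (EuclideanSpace ℝ (Fin n))) (hω : IsOpen ω) (hne : ω.Nonempty) :
    ∃ C : ℝ, 1 < C ∧ ∀ N : ℕ, ∀ f ∈ hermiteSpan n N,
      Real.sqrt (∫ x, ‖f x‖ ^ 2) ≤
        C * Real.exp ((1 / 2 : ℝ) * N * Real.log (N + 1) + C * N) *
          Real.sqrt (∫ x in ω, ‖f x‖ ^ 2) := by
  obtain ⟨x0, hx0⟩ := hne
  obtain ⟨R, hR, hball⟩ := Metric.isOpen_iff.mp hω x0 hx0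
  have hr : 0 < R / 3 := by positivity
  have hsub : Metric.closedBall x0 (2 * (R / 3)) ⊆ ω :=
    (Metric.closedBall_subset_ball (by linarith)).trans hball
  obtain ⟨K1, K2, hK1, hK2, H⟩ := aux_main n x0 (R / 3) hr
  set G := ∫ x : EuclideanSpace ℝ (Fin n), Real.exp (-(‖x‖ ^ 2) / 2) with hG
  have hG0 : 0 ≤ G := integral_nonneg fun x => (Real.exp_pos _).le
  refine ⟨2 + Real.sqrt (K1 * G) + K2, by linarith [Real.sqrt_nonneg (K1 * G)], ?_⟩
  intro N f hf
  obtain ⟨hfc, hb⟩ := H N f hf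
  set C := 2 + Real.sqrt (K1 * G) + K2 with hC
  have hC1 : Real.sqrt (K1 * G) ≤ C := by linarith
  have hC2 : K2 ≤ C := by linarith [Real.sqrt_nonneg (K1 * G)]
  have hC0 : 0 < C := by linarith [Real.sqrt_nonneg (K1 * G)]
  set J := ∫ y in Metric.closedBall x0 (2 * (R / 3)), ‖f y‖ ^ 2 with hJ
  have hint : Integrable (fun x => ‖f x‖ ^ 2) := by
    refine ((aux_gauss n).const_mul (K1 * K2 ^ N * N.factorial * J)).mono'
      (hfc.norm.pow 2).aestronglyMeasurable (ae_of_all _ fun x => ?_)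
    rw [Real.norm_eq_abs, abs_of_nonneg (by positivity)]
    exact hb x
  have hJI : J ≤ ∫ x in ω, ‖f x‖ ^ 2 :=
    setIntegral_mono_set hint.integrableOn (ae_of_all _ fun x => by positivity)
      hsub.eventuallyLE
  have hJ0 : 0 ≤ J := integral_nonneg fun y => by positivity
  have htot : ∫ x, ‖f x‖ ^ 2 ≤ K1 * K2 ^ N * N.factorial * J * G := by
    rw [hG, ← integral_const_mul]
    exact integral_mono hint ((aux_gauss n).const_mul _) hb
  have hfac : (N.factorial : ℝ) ≤ Real.exp (N * Real.log (N + 1)) := by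
    rw [mul_comm, Real.exp_mul, Real.exp_log (by positivity), Real.rpow_natCast]
    exact_mod_cast (Nat.factorial_le_pow N).trans (Nat.pow_le_pow_left (Nat.le_succ N) N)
  have hK2N : K2 ^ N ≤ Real.exp (2 * (C * N)) := by
    calc K2 ^ N ≤ (Real.exp (2 * C)) ^ N := by
          have := Real.add_one_le_exp (2 * C)
          gcongr
          linarith
      _ = _ := by rw [← Real.exp_nat_mul]; congr 1; ring
  have hK1G : K1 * G ≤ C ^ 2 := (Real.sqrt_le_left hC0.le).mp hC1
  set E := Real.exp ((1 / 2 : ℝ) * N * Real.log (N + 1) + C * N) with hE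
  have hE2 : Real.exp (2 * (C * N)) * Real.exp (N * Real.log (N + 1)) = E ^ 2 := by
    rw [hE, ← Real.exp_nat_mul, ← Real.exp_add]; congr 1; push_cast; ring
  have hfin : ∫ x, ‖f x‖ ^ 2 ≤ (C * E) ^ 2 * ∫ x in ω, ‖f x‖ ^ 2 := by
    refine htot.trans ?_
    calc K1 * K2 ^ N * N.factorial * J * G = (K1 * G) * (K2 ^ N * N.factorial) * J := by ring
      _ ≤ C ^ 2 * (Real.exp (2 * (C * N)) * Real.exp (N * Real.log (N + 1))) *
          ∫ x in ω, ‖f x‖ ^ 2 := by gcongr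
      _ = _ := by rw [hE2]; ring
  calc Real.sqrt (∫ x, ‖f x‖ ^ 2) ≤ Real.sqrt ((C * E) ^ 2 * ∫ x in ω, ‖f x‖ ^ 2) :=
        Real.sqrt_le_sqrt hfin
    _ = C * E * Real.sqrt (∫ x in ω, ‖f x‖ ^ 2) := by
        rw [Real.sqrt_mul (by positivity), Real.sqrt_sq (by positivity)]
end

section
/- For every dimension n ≥ 1 there exists a positive constant c_n > 0 depending only on n such that for all N ∈ ℕ and all f ∈ E_N, ∫_{|x| ≥ c_n √(N+1)} |f(x)|² dx ≤ (1/4) ‖f‖²_{L²(ℝⁿ)}, where |x| denotes the Euclidean norm on ℝⁿ. -/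
open MeasureTheory

open Polynomial in
/-- Physicists' Hermite polynomials. -/
noncomputable def hermQ : ℕ → Polynomial ℝ
  | 0 => 1
  | (k+1) => 2 * Polynomial.X * hermQ k - Polynomial.derivative (hermQ k)

lemma hermQ_deriv (k : ℕ) :
    Polynomial.derivative (hermQ (k+1)) = 2 * ((k:Polynomial ℝ)+1) * hermQ k := by
  induction k with
  | zero => simp [hermQ]
  | succ k ih =>
    rw [hermQ]
    simp only [Polynomial.derivative_sub, Polynomial.derivative_mul, Polynomial.derivative_X,
      Polynomial.derivative_ofNat, ih]
    have e : hermQ (k+1) = 2 * Polynomial.X * hermQ k - Polynomial.derivative (hermQ k) := rfl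
    simp
    linear_combination (-2 * ((k:Polynomial ℝ)+1)) * e

lemma hasDerivAt_poly_gauss (p : Polynomial ℝ) (x : ℝ) :
    HasDerivAt (fun y => p.eval y * Real.exp (-(y^2)))
      ((Polynomial.derivative p - 2 * Polynomial.X * p).eval x * Real.exp (-(x^2))) x := by
  have h1 := p.hasDerivAt x
  have h2 : HasDerivAt (fun y : ℝ => Real.exp (-(y^2))) (Real.exp (-(x^2)) * (-(2*x))) x := by
    have : HasDerivAt (fun y : ℝ => -(y^2)) (-(2*x)) x := by
      have h := (hasDerivAt_pow 2 x).fun_neg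
      norm_num at h
      exact h
    exact this.exp
  refine (h1.fun_mul h2).congr_deriv ?_
  simp
  ring

lemma iteratedDeriv_gauss (k : ℕ) :
    iteratedDeriv k (fun y : ℝ => Real.exp (-(y ^ 2))) =
      fun x => (-1)^k * ((hermQ k).eval x * Real.exp (-(x^2))) := by
  induction k with
  | zero => simp [hermQ]
  | succ k ih =>
    rw [iteratedDeriv_succ, ih]
    funext x
    rw [((hasDerivAt_poly_gauss (hermQ k) x).const_mul ((-1)^k)).deriv]
    simp [hermQ, pow_succ]
    ring

lemma integrable_poly_gauss (p : Polynomial ℝ) :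
    Integrable (fun y : ℝ => p.eval y * Real.exp (-(y^2))) := by
  induction p using Polynomial.induction_on' with
  | add p q hp hq =>
    simp only [Polynomial.eval_add, add_mul]
    exact hp.add hq
  | monomial n a =>
    have := (integrable_rpow_mul_exp_neg_mul_sq (b := 1) one_pos (s := n)
      (by have := n.cast_nonneg (α := ℝ); linarith)).const_mul a
    simpa [Real.rpow_natCast, mul_assoc] using this

lemma integral_parts (p : Polynomial ℝ) (k : ℕ) :
    ∫ y : ℝ, (p * hermQ (k+1)).eval y * Real.exp (-(y^2)) =
    ∫ y : ℝ, (Polynomial.derivative p * hermQ k).eval y * Real.exp (-(y^2)) := by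
  have h := integral_eq_zero_of_hasDerivAt_of_integrable
    (hasDerivAt_poly_gauss (p * hermQ k)) (integrable_poly_gauss _) (integrable_poly_gauss _)
  rw [← sub_eq_zero, ← integral_sub (integrable_poly_gauss _) (integrable_poly_gauss _),
    ← neg_eq_zero, ← integral_neg, ← h]
  congr 1
  funext y
  simp [hermQ]
  ring

lemma integral_hermQ (k l : ℕ) :
    ∫ y : ℝ, (hermQ k * hermQ l).eval y * Real.exp (-(y^2)) =
      if k = l then 2^k * (k.factorial : ℝ) * Real.sqrt Real.pi else 0 := by
  induction k generalizing l with
  | zero =>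
    cases l with
    | zero =>
      have := integral_gaussian 1
      simpa [hermQ] using this
    | succ l =>
      rw [integral_parts]
      simp [hermQ]
  | succ k ih =>
    rw [mul_comm]
    rw [integral_parts]
    cases l with
    | zero => simp [hermQ]
    | succ l =>
      rw [hermQ_deriv]
      have : ∀ y : ℝ, (2 * ((l:Polynomial ℝ)+1) * hermQ l * hermQ k).eval y * Real.exp (-(y^2)) =
        (2 * ((l:ℝ)+1)) * ((hermQ k * hermQ l).eval y * Real.exp (-(y^2))) := by
        intro y; simp; ring
      simp_rw [this]
      rw [integral_const_mul, ih]
      by_cases h : k = l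
      · subst h
        simp [Nat.factorial_succ, pow_succ]; ring
      · simp [h]

/-- The normalization constant. -/
noncomputable def hermS (k : ℕ) : ℝ := Real.sqrt (2 ^ k * Nat.factorial k * Real.sqrt Real.pi)

lemma hermS_pos (k : ℕ) : 0 < hermS k := by
  unfold hermS
  have := Real.pi_pos
  positivity

lemma hermS_sq (k : ℕ) : hermS k ^ 2 = 2 ^ k * Nat.factorial k * Real.sqrt Real.pi := by
  unfold hermS
  rw [Real.sq_sqrt]
  positivity

lemma hermS_succ (k : ℕ) : hermS (k+1) = Real.sqrt (((k:ℝ)+1)/2) * 2 * hermS k := by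
  have h2 : (2:ℝ) = Real.sqrt 4 := by
    rw [show (4:ℝ) = 2^2 by norm_num, Real.sqrt_sq (by norm_num)]
  unfold hermS
  conv_rhs => rw [h2]
  rw [← Real.sqrt_mul (by positivity), ← Real.sqrt_mul (by positivity)]
  congr 1
  rw [← h2, Nat.factorial_succ, pow_succ]
  push_cast
  ring

lemma hermiteFn_eq (k : ℕ) (x : ℝ) :
    hermiteFn k x = (hermQ k).eval x * Real.exp (-(x^2/2)) / hermS k := by
  have h1 : Real.exp (-(x^2)) = Real.exp (-(x^2/2)) * Real.exp (-(x^2/2)) := by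
    rw [← Real.exp_add]; congr 1; ring
  have h2 : Real.exp (x^2/2) * Real.exp (-(x^2/2)) = 1 := by
    rw [← Real.exp_add]; simp
  have h3 : ((-1:ℝ)^k) * (-1)^k = 1 := by
    rw [← mul_pow]; simp
  unfold hermiteFn
  rw [iteratedDeriv_gauss]
  beta_reduce
  rw [h1]
  change (-1)^k / hermS k * _ * _ = _
  calc _ = (((-1:ℝ)^k) * (-1)^k) * (Real.exp (x^2/2) * Real.exp (-(x^2/2))) *
        ((hermQ k).eval x * Real.exp (-(x^2/2)) / hermS k) := by ring
    _ = _ := by rw [h2, h3]; ring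

lemma hermiteFn_mul (k l : ℕ) (x : ℝ) :
    hermiteFn k x * hermiteFn l x =
      (hermS k * hermS l)⁻¹ * ((hermQ k * hermQ l).eval x * Real.exp (-(x^2))) := by
  have h1 : Real.exp (-(x^2)) = Real.exp (-(x^2/2)) * Real.exp (-(x^2/2)) := by
    rw [← Real.exp_add]; congr 1; ring
  rw [hermiteFn_eq, hermiteFn_eq, h1]
  simp
  ring

lemma integrable_hermiteFn_mul (k l : ℕ) :
    Integrable (fun x => hermiteFn k x * hermiteFn l x) := by
  simp_rw [hermiteFn_mul]
  exact (integrable_poly_gauss _).const_mul _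

lemma integral_hermiteFn_mul (k l : ℕ) :
    ∫ x, hermiteFn k x * hermiteFn l x = if k = l then 1 else 0 := by
  simp_rw [hermiteFn_mul]
  rw [integral_const_mul, integral_hermQ]
  by_cases h : k = l
  · subst h
    have := (hermS_pos k).ne'
    simp only [if_true]
    rw [← hermS_sq]
    field_simp
  · simp [h]

lemma continuous_hermiteFn (k : ℕ) : Continuous (hermiteFn k) := by
  have : hermiteFn k = fun x => (hermQ k).eval x * Real.exp (-(x^2/2)) / hermS k :=
    funext (hermiteFn_eq k)
  rw [this]
  fun_prop

lemma hermiteFn_rec (k : ℕ) (x : ℝ) :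
    x * hermiteFn k x = Real.sqrt ((k:ℝ)/2) * hermiteFn (k-1) x +
      Real.sqrt (((k:ℝ)+1)/2) * hermiteFn (k+1) x := by
  have key : ∀ m : ℕ, Real.sqrt (((m:ℝ)+1)/2) * hermiteFn (m+1) x =
      (hermQ (m+1)).eval x * Real.exp (-(x^2/2)) / (2 * hermS m) := by
    intro m
    have h0 := (hermS_pos m).ne'
    have h1 : Real.sqrt (((m:ℝ)+1)/2) ≠ 0 := by positivity
    rw [hermiteFn_eq, hermS_succ]
    field_simp
  rw [key]
  cases k with
  | zero =>
    have h0 := (hermS_pos 0).ne'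
    rw [hermiteFn_eq]
    simp [hermQ]
    field_simp
  | succ m =>
    have h0 := (hermS_pos m).ne'
    have h1 : Real.sqrt (((m:ℝ)+1)/2) ≠ 0 := by positivity
    have h2 : Real.sqrt (((m:ℝ)+1)/2) ^ 2 = ((m:ℝ)+1)/2 := Real.sq_sqrt (by positivity)
    have h3 : (hermQ (m+1+1)).eval x = 2 * x * (hermQ (m+1)).eval x -
      2 * ((m:ℝ)+1) * (hermQ m).eval x := by
      rw [hermQ, hermQ_deriv]; simp
    rw [h3, hermiteFn_eq, hermiteFn_eq, hermS_succ]
    push_cast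
    set s := Real.sqrt (((m:ℝ)+1)/2)
    have h4 : (m:ℝ)+1 = 2 * s^2 := by rw [h2]; ring
    rw [h4]
    field_simp
    ring

/-- Real-valued multi-dimensional Hermite functions. -/
noncomputable def hermPsi {n : ℕ} (α : Fin n → ℕ) (x : EuclideanSpace ℝ (Fin n)) : ℝ :=
  ∏ j, hermiteFn (α j) (x j)

lemma hermitePhi_eq {n : ℕ} (α : Fin n → ℕ) (x : EuclideanSpace ℝ (Fin n)) :
    hermitePhi α x = ((hermPsi α x : ℝ) : ℂ) := by
  simp [hermitePhi, hermPsi]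

lemma continuous_hermPsi {n : ℕ} (α : Fin n → ℕ) : Continuous (hermPsi α) := by
  unfold hermPsi
  refine continuous_finsetProd _ fun j _ => (continuous_hermiteFn _).comp ?_
  fun_prop

lemma integrable_hermPsi_mul {n : ℕ} (α β : Fin n → ℕ) :
    Integrable (fun x => hermPsi α x * hermPsi β x) := by
  have h : Integrable (fun x : Fin n → ℝ =>
      ∏ j, (hermiteFn (α j) (x j) * hermiteFn (β j) (x j))) :=
    Integrable.fintype_prod (f := fun j x => hermiteFn (α j) x * hermiteFn (β j) x)
      fun j => integrable_hermiteFn_mul _ _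
  have h2 := ((EuclideanSpace.volume_preserving_symm_measurableEquiv_toLp (Fin n)).integrable_comp_emb
    (MeasurableEquiv.measurableEmbedding _)).2 h
  refine h2.congr (Filter.Eventually.of_forall fun x => ?_)
  simp [hermPsi, Finset.prod_mul_distrib]

lemma integral_hermPsi_mul {n : ℕ} (α β : Fin n → ℕ) :
    ∫ x, hermPsi α x * hermPsi β x = if α = β then 1 else 0 := by
  have h := (EuclideanSpace.volume_preserving_symm_measurableEquiv_toLp (Fin n)).integral_comp
    (MeasurableEquiv.measurableEmbedding _)
    (fun x : Fin n → ℝ => ∏ j, (hermiteFn (α j) (x j) * hermiteFn (β j) (x j)))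
  rw [integral_fintype_prod_volume_eq_prod
    (f := fun j x => hermiteFn (α j) x * hermiteFn (β j) x)] at h
  simp_rw [integral_hermiteFn_mul] at h
  have e : ∫ x, hermPsi α x * hermPsi β x = ∏ j, (if α j = β j then (1:ℝ) else 0) := by
    rw [← h]
    congr 1
    funext x
    simp [hermPsi, Finset.prod_mul_distrib]
  rw [e]
  by_cases hab : α = β
  · simp [hab]
  · rw [if_neg hab]
    obtain ⟨j, hj⟩ := Function.ne_iff.1 hab
    exact Finset.prod_eq_zero (Finset.mem_univ j) (by simp [hj])

lemma normsq_expand {ι : Type*} (S : Finset ι) (d : ι → ℂ) (r : ι → ℝ) :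
    ‖∑ i ∈ S, d i * (r i : ℂ)‖ ^ 2 =
      ∑ i ∈ S, ∑ j ∈ S, (d i * (starRingEnd ℂ) (d j)).re * (r i * r j) := by
  have h : ((‖∑ i ∈ S, d i * (r i : ℂ)‖ ^ 2 : ℝ) : ℂ) =
      ∑ i ∈ S, ∑ j ∈ S, (d i * (starRingEnd ℂ) (d j)) * ((r i * r j : ℝ) : ℂ) := by
    push_cast
    rw [← Complex.mul_conj', map_sum, Finset.sum_mul_sum]
    refine Finset.sum_congr rfl fun i _ => Finset.sum_congr rfl fun j _ => ?_
    simp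
    ring
  have h2 := congrArg Complex.re h
  rw [Complex.ofReal_re] at h2
  rw [h2]
  simp only [Complex.re_sum, Complex.re_mul_ofReal]

lemma integrable_comb {n : ℕ} {ι : Type*} (S : Finset ι) (d : ι → ℂ) (β : ι → Fin n → ℕ) :
    Integrable (fun x => ‖∑ i ∈ S, d i * (hermPsi (β i) x : ℂ)‖ ^ 2) := by
  simp_rw [normsq_expand]
  exact integrable_finsetSum _ fun i _ => integrable_finsetSum _ fun j _ =>
    (integrable_hermPsi_mul _ _).const_mul _

lemma integral_comb {n : ℕ} {ι : Type*} (S : Finset ι) (d : ι → ℂ) (β : ι → Fin n → ℕ)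
    (hβ : ∀ i ∈ S, ∀ j ∈ S, i ≠ j → β i = β j → d i = 0 ∨ d j = 0) :
    ∫ x, ‖∑ i ∈ S, d i * (hermPsi (β i) x : ℂ)‖ ^ 2 = ∑ i ∈ S, ‖d i‖ ^ 2 := by
  simp_rw [normsq_expand]
  rw [integral_finsetSum _ fun i _ => integrable_finsetSum _ fun j _ =>
    (integrable_hermPsi_mul _ _).const_mul _]
  refine Finset.sum_congr rfl fun i hi => ?_
  rw [integral_finsetSum _ fun j _ => (integrable_hermPsi_mul _ _).const_mul _]
  simp_rw [integral_const_mul, integral_hermPsi_mul]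
  rw [Finset.sum_eq_single_of_mem i hi]
  · simp only [if_true, mul_one, Complex.mul_conj']
    norm_cast
  · intro j hj hji
    by_cases h : β i = β j
    · rcases hβ i hi j hj hji.symm h with h | h <;> simp [h]
    · simp [h]

lemma hermPsi_update {n : ℕ} (α : Fin n → ℕ) (j : Fin n) (m : ℕ) (x : EuclideanSpace ℝ (Fin n)) :
    hermPsi (Function.update α j m) x =
      hermiteFn m (x j) * ∏ i ∈ Finset.univ.erase j, hermiteFn (α i) (x i) := by
  unfold hermPsi
  rw [← Finset.mul_prod_erase _ _ (Finset.mem_univ j)]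
  congr 1
  · simp
  · refine Finset.prod_congr rfl fun i hi => ?_
    rw [Function.update_of_ne (Finset.ne_of_mem_erase hi)]

lemma hermPsi_rec {n : ℕ} (α : Fin n → ℕ) (j : Fin n) (x : EuclideanSpace ℝ (Fin n)) :
    x j * hermPsi α x =
      Real.sqrt ((α j:ℝ)/2) * hermPsi (Function.update α j (α j - 1)) x +
      Real.sqrt (((α j:ℝ)+1)/2) * hermPsi (Function.update α j (α j + 1)) x := by
  have h := hermPsi_update α j (α j) x
  rw [Function.update_eq_self] at h
  rw [h, hermPsi_update, hermPsi_update, ← mul_assoc, hermiteFn_rec]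
  ring

lemma coord_bound {n : ℕ} (N : ℕ) (S : Finset (Fin n → ℕ)) (hS : ∀ α ∈ S, ∑ j, α j ≤ N)
    (c : (Fin n → ℕ) → ℂ) (j : Fin n) :
    Integrable (fun x : EuclideanSpace ℝ (Fin n) =>
      (x j)^2 * ‖∑ α ∈ S, c α * (hermPsi α x : ℂ)‖ ^ 2) ∧
    ∫ x : EuclideanSpace ℝ (Fin n), (x j)^2 * ‖∑ α ∈ S, c α * (hermPsi α x : ℂ)‖ ^ 2 ≤
      2 * ((N:ℝ) + 1) * ∫ x, ‖∑ α ∈ S, c α * (hermPsi α x : ℂ)‖ ^ 2 := by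
  have hS' : ∀ α ∈ S, (α j : ℝ) ≤ N := fun α hα => by
    exact_mod_cast (Finset.single_le_sum (f := α) (fun _ _ => Nat.zero_le _)
      (Finset.mem_univ j)).trans (hS α hα)
  let d1 : (Fin n → ℕ) → ℂ := fun α => c α * (Real.sqrt ((α j:ℝ)/2) : ℝ)
  let d2 : (Fin n → ℕ) → ℂ := fun α => c α * (Real.sqrt (((α j:ℝ)+1)/2) : ℝ)
  let b1 : (Fin n → ℕ) → Fin n → ℕ := fun α => Function.update α j (α j - 1)
  let b2 : (Fin n → ℕ) → Fin n → ℕ := fun α => Function.update α j (α j + 1)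
  have i1 := integrable_comb S d1 b1
  have i2 := integrable_comb S d2 b2
  have inj : ∀ α β : Fin n → ℕ, ∀ k l : ℕ, Function.update α j k = Function.update β j l →
      (α j = β j) → α = β := by
    intro α β k l h hj
    funext i
    by_cases hi : i = j
    · rw [hi, hj]
    · have := congrFun h i
      simpa [Function.update_of_ne hi] using this
  have e1 := integral_comb S d1 b1 (by
    intro α _ β _ hne h
    by_cases ha : α j = 0
    · left; simp [d1, ha]
    by_cases hb : β j = 0
    · right; simp [d1, hb]
    refine absurd (inj α β _ _ h ?_) hne
    have := congrFun h j
    simp [b1] at this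
    omega)
  have e2 := integral_comb S d2 b2 (by
    intro α _ β _ hne h
    refine absurd (inj α β _ _ h ?_) hne
    have := congrFun h j
    simpa [b2] using this)
  have e0 := integral_comb S c id (fun _ _ _ _ hne h => absurd h hne)
  simp only [id] at e0
  have hpt : ∀ x : EuclideanSpace ℝ (Fin n),
      (x j)^2 * ‖∑ α ∈ S, c α * (hermPsi α x : ℂ)‖ ^ 2 ≤
      2 * ‖∑ i ∈ S, d1 i * (hermPsi (b1 i) x : ℂ)‖ ^ 2 +
      2 * ‖∑ i ∈ S, d2 i * (hermPsi (b2 i) x : ℂ)‖ ^ 2 := by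
    intro x
    have hx : ((x j : ℝ) : ℂ) * ∑ α ∈ S, c α * (hermPsi α x : ℂ) =
        ∑ i ∈ S, d1 i * (hermPsi (b1 i) x : ℂ) + ∑ i ∈ S, d2 i * (hermPsi (b2 i) x : ℂ) := by
      rw [Finset.mul_sum, ← Finset.sum_add_distrib]
      refine Finset.sum_congr rfl fun α _ => ?_
      have := congrArg (fun r : ℝ => (r : ℂ)) (hermPsi_rec α j x)
      simp only [Complex.ofReal_mul, Complex.ofReal_add] at this
      simp only [d1, d2, b1, b2]
      linear_combination c α * this
    have h1 : (x j)^2 * ‖∑ α ∈ S, c α * (hermPsi α x : ℂ)‖ ^ 2 =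
        ‖((x j : ℝ) : ℂ) * ∑ α ∈ S, c α * (hermPsi α x : ℂ)‖ ^ 2 := by
      rw [norm_mul, mul_pow, Complex.norm_real, Real.norm_eq_abs, sq_abs]
    rw [h1, hx]
    set u := ∑ i ∈ S, d1 i * (hermPsi (b1 i) x : ℂ)
    set v := ∑ i ∈ S, d2 i * (hermPsi (b2 i) x : ℂ)
    have := norm_add_le u v
    nlinarith [sq_nonneg (‖u‖ - ‖v‖), norm_nonneg (u+v), norm_nonneg u, norm_nonneg v]
  have hint := (i1.const_mul 2).add (i2.const_mul 2)
  have hI : Integrable (fun x : EuclideanSpace ℝ (Fin n) =>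
      (x j)^2 * ‖∑ α ∈ S, c α * (hermPsi α x : ℂ)‖ ^ 2) := by
    refine hint.mono' ?_ (Filter.Eventually.of_forall fun x => ?_)
    · refine Continuous.aestronglyMeasurable ?_
      have := fun α : Fin n → ℕ => continuous_hermPsi α
      fun_prop
    · rw [Real.norm_of_nonneg (by positivity)]
      exact hpt x
  refine ⟨hI, (integral_mono hI hint hpt).trans ?_⟩
  simp only [Pi.add_apply]
  rw [integral_add (i1.const_mul 2) (i2.const_mul 2), integral_const_mul, integral_const_mul,
    e1, e2, e0, Finset.mul_sum, Finset.mul_sum, Finset.mul_sum, ← Finset.sum_add_distrib]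
  refine Finset.sum_le_sum fun α hα => ?_
  simp only [d1, d2, norm_mul, mul_pow, Complex.norm_real, Real.norm_eq_abs, sq_abs]
  rw [Real.sq_sqrt (by positivity), Real.sq_sqrt (by positivity)]
  have := hS' α hα
  nlinarith [sq_nonneg ‖c α‖]

/-- **Uniform tail estimate for finite combinations of Hermite functions.** For every
`n ≥ 1` there exists `c_n > 0` such that for all `N ∈ ℕ` and all `f ∈ E_N`,
`∫_{|x| ≥ c_n √(N+1)} |f(x)|² dx ≤ (1/4) ‖f‖²_{L²(ℝⁿ)}`. -/
theorem hermite_combination_tail (n : ℕ) (hn : 1 ≤ n) :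
    ∃ c : ℝ, 0 < c ∧ ∀ N : ℕ, ∀ f ∈ hermiteSpan n N,
      (∫ x in {x : EuclideanSpace ℝ (Fin n) | c * Real.sqrt (N + 1) ≤ ‖x‖}, ‖f x‖ ^ 2) ≤
        (1 / 4 : ℝ) * ∫ x, ‖f x‖ ^ 2 := by
  have hn' : (0:ℝ) < n := by exact_mod_cast hn
  refine ⟨Real.sqrt (8 * n), by positivity, fun N f hf => ?_⟩
  have hset : {f : EuclideanSpace ℝ (Fin n) → ℂ | ∃ α : Fin n → ℕ, (∑ j, α j) ≤ N ∧
      f = hermitePhi α} = hermitePhi '' {α : Fin n → ℕ | ∑ j, α j ≤ N} := by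
    ext g
    simp only [Set.mem_setOf_eq, Set.mem_image]
    exact exists_congr fun α => and_congr_right fun _ => eq_comm
  rw [hermiteSpan, hset, Finsupp.mem_span_image_iff_linearCombination] at hf
  obtain ⟨l, hl, rfl⟩ := hf
  have hfx : ∀ x, Finsupp.linearCombination ℂ (hermitePhi (n := n)) l x =
      ∑ α ∈ l.support, l α * (hermPsi α x : ℂ) := by
    intro x
    rw [Finsupp.linearCombination_apply, Finsupp.sum, Finset.sum_apply]
    refine Finset.sum_congr rfl fun α _ => ?_
    rw [Pi.smul_apply, smul_eq_mul, hermitePhi_eq]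
  simp_rw [hfx]
  have hS : ∀ α ∈ l.support, ∑ j, α j ≤ N := fun α hα => hl hα
  have hcb := coord_bound N l.support hS l
  have hint := integrable_comb l.support l id
  simp only [id] at hint
  set F : EuclideanSpace ℝ (Fin n) → ℝ := fun x => ‖∑ α ∈ l.support, l α * (hermPsi α x : ℂ)‖ ^ 2
    with hF
  have hFnn : ∀ x, 0 ≤ F x := fun x => by positivity
  have hnorm : ∀ x : EuclideanSpace ℝ (Fin n), ‖x‖^2 * F x = ∑ j, (x j)^2 * F x := by
    intro x
    rw [EuclideanSpace.norm_sq_eq, Finset.sum_mul]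
    simp
  have hI2 : Integrable (fun x => ‖x‖^2 * F x) := by
    simp_rw [hnorm]
    exact integrable_finsetSum _ fun j _ => (hcb j).1
  have hB : ∫ x, ‖x‖^2 * F x ≤ n * (2 * ((N:ℝ)+1) * ∫ x, F x) := by
    simp_rw [hnorm]
    rw [integral_finsetSum _ fun j _ => (hcb j).1]
    refine (Finset.sum_le_sum fun j _ => (hcb j).2).trans ?_
    simp [hF]
  have hm : MeasurableSet {x : EuclideanSpace ℝ (Fin n) |
      Real.sqrt (8 * n) * Real.sqrt (N + 1) ≤ ‖x‖} :=
    measurableSet_le measurable_const measurable_norm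
  have hK : (0:ℝ) < 8 * n * (N+1) := by positivity
  have step : ∫ x in {x : EuclideanSpace ℝ (Fin n) |
      Real.sqrt (8 * n) * Real.sqrt (N + 1) ≤ ‖x‖}, F x ≤
      ∫ x, (8 * n * ((N:ℝ)+1))⁻¹ * (‖x‖^2 * F x) := by
    refine (setIntegral_mono_on hint.integrableOn (hI2.const_mul _).integrableOn hm ?_).trans
      (setIntegral_le_integral (hI2.const_mul _) (Filter.Eventually.of_forall fun x => ?_))
    · intro x hx
      have h1 : 8 * n * ((N:ℝ)+1) ≤ ‖x‖^2 := by
        have h2 := pow_le_pow_left₀ (by positivity) (Set.mem_setOf_eq ▸ hx) 2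
        rwa [mul_pow, Real.sq_sqrt (by positivity), Real.sq_sqrt (by positivity)] at h2
      change F x ≤ _
      rw [inv_mul_eq_div, le_div_iff₀ hK, mul_comm]
      exact mul_le_mul_of_nonneg_right h1 (hFnn x)
    · have := hFnn x
      simp only [Pi.zero_apply]
      positivity
  refine step.trans ?_
  rw [integral_const_mul, inv_mul_eq_div, div_le_iff₀ hK]
  refine hB.trans (le_of_eq ?_)
  ring
end

section
/- For every N ∈ ℕ, every f ∈ E_N, every 0 < δ ≤ 1 and all multi-indices α, β ∈ ℕⁿ, one has ‖x^α ∂_x^β f‖_{L²(ℝⁿ)} ≤ e^{e/(2δ²)} · (2δ)^{|α|+|β|} · (|α|+|β|)! · e^{δ^{−1}√N} · ‖f‖_{L²(ℝⁿ)}, where x^α = x₁^{α₁}⋯x_n^{α_n} and ∂_x^β = ∂_{x₁}^{β₁}⋯∂_{x_n}^{β_n}. -/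
open MeasureTheory

noncomputable section

/-- The partial derivative `∂_{x_j}` of a function on `ℝⁿ`. -/
def partialDerivE {n : ℕ} (j : Fin n) (f : EuclideanSpace ℝ (Fin n) → ℂ) :
    EuclideanSpace ℝ (Fin n) → ℂ :=
  fun x => fderiv ℝ f x (EuclideanSpace.single j 1)

/-- The iterated partial derivative `∂_x^β = ∂_{x_1}^{β_1} ⋯ ∂_{x_n}^{β_n}`. -/
def multiDerivE {n : ℕ} (β : Fin n → ℕ) (f : EuclideanSpace ℝ (Fin n) → ℂ) :
    EuclideanSpace ℝ (Fin n) → ℂ :=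
  (List.finRange n).foldr (fun j g => (partialDerivE j)^[β j] g) f

end

namespace HWB
noncomputable def g (k : ℕ) : ℝ → ℝ := iteratedDeriv k (fun y => Real.exp (-(y ^ 2)))

lemma g_contDiff : ContDiff ℝ ⊤ (fun y : ℝ => Real.exp (-(y ^ 2))) := by fun_prop

lemma g_hasDerivAt (k : ℕ) (x : ℝ) : HasDerivAt (g k) (g (k+1) x) x := by
  unfold g
  rw [iteratedDeriv_succ]
  have := (g_contDiff.of_le (m := (k+1 : ℕ)) (by exact_mod_cast le_top)).differentiable_iteratedDeriv k (by exact_mod_cast Nat.lt_succ_self k)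
  exact (this x).hasDerivAt

lemma g_zero (x : ℝ) : g 0 x = Real.exp (-(x^2)) := by simp [g]

lemma g_one (x : ℝ) : g 1 x = -2 * x * g 0 x := by
  have h1 : HasDerivAt (g 0) (Real.exp (-(x^2)) * (-(2 * x))) x := by
    have : g 0 = fun x => Real.exp (-(x^2)) := funext g_zero
    rw [this]
    have := ((hasDerivAt_pow 2 x).neg).exp
    simpa using this
  rw [(g_hasDerivAt 0 x).unique h1, g_zero]; ring

lemma g_rec (k : ℕ) : ∀ x, g (k+2) x = -2 * x * g (k+1) x - 2 * (k+1) * g k x := by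
  induction k with
  | zero =>
    intro x
    have h := ((hasDerivAt_id x).const_mul (-2)).mul (g_hasDerivAt 0 x)
    have e : g 1 = (fun y => -2 * id y) * g 0 := by
      funext y; simp [g_one]
    rw [← e] at h
    have := (g_hasDerivAt 1 x).unique h
    rw [this]; simp; ring
  | succ k ih =>
    intro x
    have h := (((hasDerivAt_id x).const_mul (-2)).mul (g_hasDerivAt (k+1) x)).sub ((g_hasDerivAt k x).const_mul (2*((k:ℝ)+1)))
    have e : g (k+2) = ((fun y => -2 * id y) * g (k+1)) - (fun y => (2*((k:ℝ)+1)) * g k y) := by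
      funext y; simp [ih]
    rw [← e] at h
    have := (g_hasDerivAt (k+2) x).unique h
    rw [this]; simp; ring

lemma g_poly (k : ℕ) : ∃ p : Polynomial ℝ, ∀ x, g k x = p.eval x * Real.exp (-(x^2)) := by
  induction k using Nat.twoStepInduction with
  | zero => exact ⟨1, fun x => by simp [g_zero]⟩
  | one => exact ⟨Polynomial.C (-2) * Polynomial.X, fun x => by simp [g_one, g_zero]⟩
  | more k h1 h2 =>
    obtain ⟨p, hp⟩ := h1
    obtain ⟨q, hq⟩ := h2
    refine ⟨Polynomial.C (-2) * Polynomial.X * q - Polynomial.C (2 * ((k:ℝ)+1)) * p, fun x => ?_⟩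
    rw [g_rec, hp, hq]; simp; ring

noncomputable def cc (k : ℕ) : ℝ := (-1 : ℝ) ^ k / Real.sqrt (2 ^ k * Nat.factorial k * Real.sqrt Real.pi)

lemma cc_succ (k : ℕ) : cc k = - (Real.sqrt (2 * ((k:ℝ)+1)) * cc (k+1)) := by
  unfold cc
  have h : (2:ℝ) ^ (k+1) * Nat.factorial (k+1) * Real.sqrt Real.pi = (2 * ((k:ℝ)+1)) * (2 ^ k * Nat.factorial k * Real.sqrt Real.pi) := by
    rw [Nat.factorial_succ]; push_cast; ring
  rw [h, Real.sqrt_mul (x := 2 * ((k:ℝ)+1)) (by positivity)]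
  have : Real.sqrt (2 * ((k:ℝ)+1)) ≠ 0 := by positivity
  have : Real.sqrt (2 ^ k * Nat.factorial k * Real.sqrt Real.pi) ≠ 0 := by positivity
  generalize Real.sqrt (2 ^ k * Nat.factorial k * Real.sqrt Real.pi) = z at *
  generalize Real.sqrt (2 * ((k:ℝ)+1)) = w at *
  field_simp
  ring

lemma herm_eq (k : ℕ) (x : ℝ) : hermiteFn k x = cc k * Real.exp (x^2/2) * g k x := rfl

lemma herm_hasDerivAt (k : ℕ) (x : ℝ) : HasDerivAt (hermiteFn k)
    (x * hermiteFn k x - Real.sqrt (2 * ((k:ℝ)+1)) * hermiteFn (k+1) x) x := by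
  have e : hermiteFn k = (fun y => cc k * Real.exp (y^2/2)) * g k := by
    funext y; simp [herm_eq]
  have h1 : HasDerivAt (fun y : ℝ => Real.exp (y^2/2)) (Real.exp (x^2/2) * x) x := by
    have := ((hasDerivAt_pow 2 x).div_const 2).exp
    simpa using this
  have h := (h1.const_mul (cc k)).mul (g_hasDerivAt k x)
  rw [← e] at h
  refine h.congr_deriv ?_
  rw [herm_eq, herm_eq, cc_succ k]; ring

lemma herm_x_zero (x : ℝ) : 2 * x * hermiteFn 0 x = Real.sqrt (2 * ((0:ℕ)+1)) * hermiteFn 1 x := by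
  rw [herm_eq, herm_eq, cc_succ 0, g_one]; push_cast; ring

lemma herm_x_succ (k : ℕ) (x : ℝ) : 2 * x * hermiteFn (k+1) x =
    Real.sqrt (2 * ((k+1:ℕ)+1)) * hermiteFn (k+2) x + Real.sqrt (2 * ((k:ℝ)+1)) * hermiteFn k x := by
  rw [herm_eq, herm_eq, herm_eq, cc_succ k, cc_succ (k+1), g_rec]
  have : Real.sqrt (2 * ((k:ℝ)+1)) * Real.sqrt (2 * ((k:ℝ)+1)) = 2 * ((k:ℝ)+1) := Real.mul_self_sqrt (by positivity)
  push_cast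
  linear_combination (-Real.sqrt (2 * ((k:ℝ)+1+1)) * cc (k+1+1) * Real.exp (x^2/2) * g k x) * this

lemma herm_x (k : ℕ) (x : ℝ) : 2 * x * hermiteFn k x =
    Real.sqrt (2 * ((k:ℝ)+1)) * hermiteFn (k+1) x + Real.sqrt (2 * (k:ℝ)) * hermiteFn (k-1) x := by
  cases k with
  | zero => rw [herm_x_zero]; simp
  | succ k => rw [herm_x_succ]; push_cast; simp

lemma poly_gauss_int (p : Polynomial ℝ) : Integrable (fun x : ℝ => p.eval x * Real.exp (-(x^2))) := by
  induction p using Polynomial.induction_on' with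
  | add p q hp hq =>
    simp only [Polynomial.eval_add, add_mul]; exact hp.add hq
  | monomial n a =>
    have := (integrable_rpow_mul_exp_neg_mul_sq (b := 1) one_pos (s := n) (lt_of_lt_of_le (by norm_num) (Nat.cast_nonneg n))).const_mul a
    simp only [Polynomial.eval_monomial]
    simpa [mul_assoc] using this

lemma herm_int (k l : ℕ) : Integrable (fun x => hermiteFn k x * hermiteFn l x) := by
  obtain ⟨p, hp⟩ := g_poly k
  obtain ⟨q, hq⟩ := g_poly l
  convert poly_gauss_int (Polynomial.C (cc k * cc l) * p * q) using 2 with x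
  rw [herm_eq, herm_eq, hp, hq]
  simp only [Polynomial.eval_mul, Polynomial.eval_C]
  have : Real.exp (x^2/2) * Real.exp (x^2/2) * Real.exp (-(x^2)) = 1 := by
    rw [← Real.exp_add, ← Real.exp_add]; ring_nf; simp
  linear_combination (cc k * cc l * p.eval x * q.eval x * Real.exp (-(x^2))) * this

lemma herm_rec (k l : ℕ) : Real.sqrt (2 * ((k:ℝ)+1)) * ∫ x, hermiteFn (k+1) x * hermiteFn l x =
    Real.sqrt (2 * (l:ℝ)) * ∫ x, hermiteFn k x * hermiteFn (l-1) x := by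
  have hd : ∀ x, HasDerivAt (fun x => hermiteFn k x * hermiteFn l x)
      (Real.sqrt (2 * (l:ℝ)) * (hermiteFn k x * hermiteFn (l-1) x) - Real.sqrt (2 * ((k:ℝ)+1)) * (hermiteFn (k+1) x * hermiteFn l x)) x := by
    intro x
    refine ((herm_hasDerivAt k x).mul (herm_hasDerivAt l x)).congr_deriv ?_
    linear_combination hermiteFn k x * herm_x l x
  have i1 := (herm_int k (l-1)).const_mul (Real.sqrt (2 * (l:ℝ)))
  have i2 := (herm_int (k+1) l).const_mul (Real.sqrt (2 * ((k:ℝ)+1)))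
  have := integral_eq_zero_of_hasDerivAt_of_integrable hd (i1.sub i2) (herm_int k l)
  rw [integral_sub i1 i2, integral_const_mul, integral_const_mul] at this
  linarith

lemma herm_orth (k l : ℕ) : ∫ x, hermiteFn k x * hermiteFn l x = if k = l then 1 else 0 := by
  induction k generalizing l with
  | zero =>
    cases l with
    | zero =>
      have : ∀ x, hermiteFn 0 x * hermiteFn 0 x = (Real.sqrt Real.pi)⁻¹ * Real.exp (-1 * x^2) := by
        intro x
        rw [herm_eq, g_zero]
        have h : Real.exp (x^2/2) * Real.exp (x^2/2) * Real.exp (-(x^2)) = 1 := by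
          rw [← Real.exp_add, ← Real.exp_add]; ring_nf; simp
        have hc : cc 0 * cc 0 = (Real.sqrt Real.pi)⁻¹ := by
          unfold cc; simp
          rw [← mul_inv, Real.mul_self_sqrt (by positivity)]
        rw [neg_one_mul]
        linear_combination (cc 0 * cc 0 * Real.exp (-(x^2))) * h + Real.exp (-(x^2)) * hc
      simp_rw [this]
      rw [integral_const_mul, integral_gaussian]
      have : Real.sqrt Real.pi ≠ 0 := by positivity
      simp [this]
    | succ l =>
      have := herm_rec l 0
      simp only [Nat.cast_zero, mul_zero, Real.sqrt_zero, zero_mul] at this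
      have h0 : Real.sqrt (2 * ((l:ℝ)+1)) ≠ 0 := by positivity
      simpa [mul_comm, h0] using (mul_eq_zero.1 this).resolve_left h0
  | succ k ih =>
    have := herm_rec k l
    have h0 : Real.sqrt (2 * ((k:ℝ)+1)) ≠ 0 := by positivity
    rw [ih] at this
    cases l with
    | zero =>
      simp only [Nat.cast_zero, mul_zero, Real.sqrt_zero, zero_mul] at this
      simpa using (mul_eq_zero.1 this).resolve_left h0
    | succ l =>
      by_cases h : k = l
      · subst h
        simp at this ⊢
        exact mul_left_cancel₀ h0 (by simpa using this)
      · simp [h] at this ⊢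
        exact (this.resolve_left (by positivity))

lemma phi_split {n : ℕ} (γ : Fin n → ℕ) (j : Fin n) (x : EuclideanSpace ℝ (Fin n)) :
    hermitePhi γ x = (hermiteFn (γ j) (x j) : ℂ) *
      ∏ i ∈ Finset.univ.erase j, (hermiteFn (γ i) (x i) : ℂ) := by
  unfold hermitePhi
  exact (Finset.mul_prod_erase Finset.univ (fun i => (hermiteFn (γ i) (x i) : ℂ)) (Finset.mem_univ j)).symm

lemma phi_update {n : ℕ} (γ : Fin n → ℕ) (j : Fin n) (m : ℕ) (x : EuclideanSpace ℝ (Fin n)) :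
    hermitePhi (Function.update γ j m) x = (hermiteFn m (x j) : ℂ) *
      ∏ i ∈ Finset.univ.erase j, (hermiteFn (γ i) (x i) : ℂ) := by
  rw [phi_split _ j, Function.update_self]
  congr 1
  refine Finset.prod_congr rfl fun i hi => ?_
  rw [Function.update_of_ne (Finset.ne_of_mem_erase hi)]

lemma phi_diff {n : ℕ} (γ : Fin n → ℕ) : Differentiable ℝ (hermitePhi γ) := by
  have : ∀ k, Differentiable ℝ (hermiteFn k) := fun k x => (herm_hasDerivAt k x).differentiableAt
  unfold hermitePhi
  intro x
  refine (HasFDerivAt.finsetProd (fun i _ => DifferentiableAt.hasFDerivAt ?_)).differentiableAt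
  have h1 : DifferentiableAt ℝ (fun y : EuclideanSpace ℝ (Fin n) => hermiteFn (γ i) (y i)) x :=
    (this (γ i) _).comp x (by fun_prop)
  exact (Complex.ofRealCLM.differentiableAt).comp x h1

lemma phi_partial {n : ℕ} (γ : Fin n → ℕ) (j : Fin n) (x : EuclideanSpace ℝ (Fin n)) :
    partialDerivE j (hermitePhi γ) x = (x j : ℂ) * hermitePhi γ x -
      (Real.sqrt (2 * ((γ j : ℝ) + 1)) : ℂ) * hermitePhi (Function.update γ j (γ j + 1)) x := by
  unfold partialDerivE
  rw [← (phi_diff γ x).lineDeriv_eq_fderiv, lineDeriv]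
  have e : (fun t : ℝ => hermitePhi γ (x + t • EuclideanSpace.single j (1:ℝ))) =
      fun t => (hermiteFn (γ j) (x j + t) : ℂ) * ∏ i ∈ Finset.univ.erase j, (hermiteFn (γ i) (x i) : ℂ) := by
    funext t
    rw [phi_split γ j]
    congr 1
    · simp
    · refine Finset.prod_congr rfl fun i hi => ?_
      simp [Finset.ne_of_mem_erase hi]
  rw [e, phi_update, phi_split γ j]
  have h0 : HasDerivAt (fun t => hermiteFn (γ j) (x j + t))
      (x j * hermiteFn (γ j) (x j) - Real.sqrt (2 * ((γ j : ℝ) + 1)) * hermiteFn (γ j + 1) (x j)) 0 :=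
    HasDerivAt.comp_const_add (x j) 0 (by rw [add_zero]; exact herm_hasDerivAt (γ j) (x j))
  rw [(h0.ofReal_comp.mul_const _).deriv]
  push_cast
  ring

lemma phi_x {n : ℕ} (γ : Fin n → ℕ) (j : Fin n) (x : EuclideanSpace ℝ (Fin n)) :
    2 * (x j : ℂ) * hermitePhi γ x =
      (Real.sqrt (2 * ((γ j : ℝ) + 1)) : ℂ) * hermitePhi (Function.update γ j (γ j + 1)) x +
      (Real.sqrt (2 * (γ j : ℝ)) : ℂ) * hermitePhi (Function.update γ j (γ j - 1)) x := by
  rw [phi_update, phi_update, phi_split γ j]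
  have := congrArg (fun r : ℝ => (r : ℂ)) (herm_x (γ j) (x j))
  push_cast at this
  linear_combination (∏ i ∈ Finset.univ.erase j, (hermiteFn (γ i) (x i) : ℂ)) * this

lemma phi_mul_eq {n : ℕ} (γ γ' : Fin n → ℕ) (x : EuclideanSpace ℝ (Fin n)) :
    hermitePhi γ x * hermitePhi γ' x = ((∏ j, (hermiteFn (γ j) (x j) * hermiteFn (γ' j) (x j)) : ℝ) : ℂ) := by
  unfold hermitePhi
  rw [← Finset.prod_mul_distrib]; push_cast; rfl

lemma phi_int {n : ℕ} (γ γ' : Fin n → ℕ) :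
    Integrable (fun x : EuclideanSpace ℝ (Fin n) => hermitePhi γ x * hermitePhi γ' x) := by
  simp_rw [phi_mul_eq]
  apply Integrable.ofReal
  rw [← (PiLp.volume_preserving_toLp (Fin n)).integrable_comp_emb (MeasurableEquiv.toLp 2 _).measurableEmbedding]
  exact Integrable.fintype_prod (f := fun j t => hermiteFn (γ j) t * hermiteFn (γ' j) t) (fun j => herm_int _ _)

lemma phi_orth {n : ℕ} (γ γ' : Fin n → ℕ) :
    ∫ x : EuclideanSpace ℝ (Fin n), hermitePhi γ x * hermitePhi γ' x = if γ = γ' then 1 else 0 := by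
  simp_rw [phi_mul_eq]
  rw [integral_complex_ofReal, ← (PiLp.volume_preserving_toLp (Fin n)).integral_comp (MeasurableEquiv.toLp 2 _).measurableEmbedding]
  have := integral_fintype_prod_volume_eq_prod (𝕜 := ℝ) (fun (j : Fin n) t => hermiteFn (γ j) t * hermiteFn (γ' j) t)
  simp only [] at this ⊢
  rw [this]
  simp_rw [herm_orth]
  rw [Finset.prod_ite_zero]
  simp only [funext_iff, Finset.mem_univ, true_imp_iff, Finset.prod_const_one]
  split_ifs <;> simp

lemma phi_conj {n : ℕ} (γ : Fin n → ℕ) (x : EuclideanSpace ℝ (Fin n)) :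
    (starRingEnd ℂ) (hermitePhi γ x) = hermitePhi γ x := by
  simp [hermitePhi]

lemma norm_sq_expand {n : ℕ} (s : Finset (Fin n → ℕ)) (τ : (Fin n → ℕ) → (Fin n → ℕ))
    (c : (Fin n → ℕ) → ℂ) (x : EuclideanSpace ℝ (Fin n)) :
    ((‖∑ γ ∈ s, c γ * hermitePhi (τ γ) x‖ ^ 2 : ℝ) : ℂ) =
     ∑ γ ∈ s, ∑ γ' ∈ s, (c γ * (starRingEnd ℂ) (c γ')) * (hermitePhi (τ γ) x * hermitePhi (τ γ') x) := by
  rw [Complex.ofReal_pow, ← Complex.mul_conj', map_sum, Finset.sum_mul_sum]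
  refine Finset.sum_congr rfl fun _ _ => Finset.sum_congr rfl fun _ _ => ?_
  rw [map_mul, phi_conj]; ring

lemma sum_int {n : ℕ} (s : Finset (Fin n → ℕ)) (τ : (Fin n → ℕ) → (Fin n → ℕ))
    (c : (Fin n → ℕ) → ℂ) :
    Integrable (fun x : EuclideanSpace ℝ (Fin n) => ‖∑ γ ∈ s, c γ * hermitePhi (τ γ) x‖ ^ 2) := by
  have : Integrable (fun x : EuclideanSpace ℝ (Fin n) => ((‖∑ γ ∈ s, c γ * hermitePhi (τ γ) x‖ ^ 2 : ℝ) : ℂ)) := by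
    simp_rw [norm_sq_expand]
    exact integrable_finsetSum _ fun _ _ => integrable_finsetSum _ fun _ _ => (phi_int _ _).const_mul _
  exact this.re

lemma sum_norm {n : ℕ} (s : Finset (Fin n → ℕ)) (τ : (Fin n → ℕ) → (Fin n → ℕ))
    (hτ : Set.InjOn τ s) (c : (Fin n → ℕ) → ℂ) :
    ∫ x : EuclideanSpace ℝ (Fin n), ‖∑ γ ∈ s, c γ * hermitePhi (τ γ) x‖ ^ 2 = ∑ γ ∈ s, ‖c γ‖ ^ 2 := by
  have : ((∫ x : EuclideanSpace ℝ (Fin n), ‖∑ γ ∈ s, c γ * hermitePhi (τ γ) x‖ ^ 2 : ℝ) : ℂ) =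
      ((∑ γ ∈ s, ‖c γ‖ ^ 2 : ℝ) : ℂ) := by
    rw [← integral_complex_ofReal]
    have h := norm_sq_expand s τ c
    simp_rw [h]
    rw [integral_finsetSum _ fun _ _ => integrable_finsetSum _ fun _ _ => (phi_int _ _).const_mul _]
    push_cast
    refine Finset.sum_congr rfl fun γ hγ => ?_
    rw [integral_finsetSum _ fun _ _ => (phi_int _ _).const_mul _]
    simp_rw [integral_const_mul, phi_orth]
    rw [Finset.sum_eq_single γ]
    · simp [Complex.mul_conj']
    · intro b hb hbγ
      rw [if_neg (fun h => hbγ (hτ hγ hb h).symm)]; simp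
    · exact fun h => absurd hγ h
  exact_mod_cast this

lemma span_repr {n M : ℕ} {f : EuclideanSpace ℝ (Fin n) → ℂ} (hf : f ∈ hermiteSpan n M) :
    ∃ (s : Finset (Fin n → ℕ)) (c : (Fin n → ℕ) → ℂ), (∀ γ ∈ s, ∑ j, γ j ≤ M) ∧
      f = fun x => ∑ γ ∈ s, c γ * hermitePhi γ x := by
  have h : {f | ∃ α : Fin n → ℕ, (∑ j, α j) ≤ M ∧ f = hermitePhi α} =
      Set.image hermitePhi {α : Fin n → ℕ | (∑ j, α j) ≤ M} := by
    ext g; simp [eq_comm]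
  rw [hermiteSpan, h, Finsupp.mem_span_image_iff_linearCombination] at hf
  obtain ⟨l, hl, rfl⟩ := hf
  refine ⟨l.support, l, fun γ hγ => (Finsupp.mem_supported _ _).1 hl hγ, ?_⟩
  funext x
  simp [Finsupp.linearCombination_apply, Finsupp.sum]

lemma sum_mem {n M : ℕ} (s : Finset (Fin n → ℕ)) (τ : (Fin n → ℕ) → (Fin n → ℕ))
    (c : (Fin n → ℕ) → ℂ) (h : ∀ γ ∈ s, ∑ j, τ γ j ≤ M) :
    (fun x => ∑ γ ∈ s, c γ * hermitePhi (τ γ) x) ∈ hermiteSpan n M := by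
  have e : (fun x => ∑ γ ∈ s, c γ * hermitePhi (τ γ) x) = ∑ γ ∈ s, c γ • hermitePhi (τ γ) := by
    funext x; simp
  rw [e]
  exact Submodule.sum_mem _ fun γ hγ => Submodule.smul_mem _ _ (Submodule.subset_span ⟨_, h γ hγ, rfl⟩)

lemma sum_update {n : ℕ} (γ : Fin n → ℕ) (j : Fin n) (m : ℕ) :
    ∑ i, Function.update γ j m i + γ j = ∑ i, γ i + m := by
  rw [Finset.sum_update_of_mem (Finset.mem_univ j), ← Finset.add_sum_erase _ γ (Finset.mem_univ j),
    Finset.sdiff_singleton_eq_erase]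
  omega

lemma step {n M : ℕ} {f : EuclideanSpace ℝ (Fin n) → ℂ} (hf : f ∈ hermiteSpan n M) (j : Fin n) :
    ((fun x => (x j : ℂ) * f x) ∈ hermiteSpan n (M+1) ∧
      ∫ x, ‖(x j : ℂ) * f x‖ ^ 2 ≤ 2 * ((M:ℝ)+1) * ∫ x, ‖f x‖ ^ 2) ∧
    (partialDerivE j f ∈ hermiteSpan n (M+1) ∧
      ∫ x, ‖partialDerivE j f x‖ ^ 2 ≤ 2 * ((M:ℝ)+1) * ∫ x, ‖f x‖ ^ 2) := by
  obtain ⟨s, c, hs, rfl⟩ := span_repr hf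
  set f : EuclideanSpace ℝ (Fin n) → ℂ := fun x => ∑ γ ∈ s, c γ * hermitePhi γ x with hfdef
  have hle : ∀ γ ∈ s, γ j ≤ M := fun γ hγ =>
    (Finset.single_le_sum (f := γ) (fun _ _ => Nat.zero_le _) (Finset.mem_univ j)).trans (hs γ hγ)
  let up : (Fin n → ℕ) → (Fin n → ℕ) := fun γ => Function.update γ j (γ j + 1)
  let dn : (Fin n → ℕ) → (Fin n → ℕ) := fun γ => Function.update γ j (γ j - 1)
  let cu : (Fin n → ℕ) → ℂ := fun γ => c γ * (Real.sqrt (2 * ((γ j : ℝ) + 1)) : ℂ)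
  let cd : (Fin n → ℕ) → ℂ := fun γ => c γ * (Real.sqrt (2 * (γ j : ℝ)) : ℂ)
  let s' := s.filter fun γ => γ j ≠ 0
  let U : EuclideanSpace ℝ (Fin n) → ℂ := fun x => ∑ γ ∈ s, cu γ * hermitePhi (up γ) x
  let D : EuclideanSpace ℝ (Fin n) → ℂ := fun x => ∑ γ ∈ s', cd γ * hermitePhi (dn γ) x
  have hD : ∀ x, D x = ∑ γ ∈ s, cd γ * hermitePhi (dn γ) x := by
    intro x
    refine Finset.sum_filter_of_ne fun γ _ h h0 => h ?_
    simp [cd, h0]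
  have hX : ∀ x, (x j : ℂ) * f x = (1/2 : ℂ) * (U x + D x) := by
    intro x
    rw [hD]
    simp only [U, hfdef]
    rw [← Finset.sum_add_distrib, Finset.mul_sum, Finset.mul_sum]
    refine Finset.sum_congr rfl fun γ _ => ?_
    have := phi_x γ j x
    simp only [cu, cd, up, dn]
    linear_combination (c γ / 2) * this
  have hP : ∀ x, partialDerivE j f x = (1/2 : ℂ) * (D x - U x) := by
    intro x
    have e1 : partialDerivE j f x = ∑ γ ∈ s, c γ * partialDerivE j (hermitePhi γ) x := by
      have : HasFDerivAt f (∑ γ ∈ s, c γ • fderiv ℝ (hermitePhi γ) x) x := by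
        exact HasFDerivAt.fun_sum fun γ _ => (phi_diff γ x).hasFDerivAt.const_mul (c γ)
      unfold partialDerivE
      rw [this.fderiv]; simp
    rw [e1, hD]
    simp only [U]
    rw [← Finset.sum_sub_distrib, Finset.mul_sum]
    refine Finset.sum_congr rfl fun γ _ => ?_
    rw [phi_partial]
    have := phi_x γ j x
    simp only [cu, cd, up, dn]
    linear_combination (c γ / 2) * this
  have hUmem : U ∈ hermiteSpan n (M+1) := sum_mem s up cu fun γ hγ => by
    have := sum_update γ j (γ j + 1)
    have := hs γ hγ
    simp only [up]; omega
  have hDmem : D ∈ hermiteSpan n (M+1) := sum_mem s' dn cd fun γ hγ => by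
    have := sum_update γ j (γ j - 1)
    have := hs γ (Finset.mem_filter.1 hγ).1
    simp only [dn]; omega
  have hUn : ∫ x, ‖U x‖ ^ 2 = ∑ γ ∈ s, ‖cu γ‖ ^ 2 := sum_norm s up (by
    intro a _ b _ hab
    funext i
    have := congrFun hab i
    by_cases h : i = j
    · subst h; simpa [up] using this
    · simpa [up, h] using this) cu
  have hDn : ∫ x, ‖D x‖ ^ 2 = ∑ γ ∈ s', ‖cd γ‖ ^ 2 := sum_norm s' dn (by
    intro a ha b hb hab
    have ha := (Finset.mem_filter.1 ha).2
    have hb := (Finset.mem_filter.1 hb).2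
    funext i
    have := congrFun hab i
    by_cases h : i = j
    · subst h; simp [dn] at this; omega
    · simpa [dn, h] using this) cd
  have hfn : ∫ x, ‖f x‖ ^ 2 = ∑ γ ∈ s, ‖c γ‖ ^ 2 := sum_norm s id Function.injective_id.injOn c
  have iU : Integrable fun x => ‖U x‖ ^ 2 := sum_int s up cu
  have iD : Integrable fun x => ‖D x‖ ^ 2 := sum_int s' dn cd
  have bU : ∫ x, ‖U x‖ ^ 2 ≤ 2 * ((M:ℝ)+1) * ∫ x, ‖f x‖ ^ 2 := by
    rw [hUn, hfn, Finset.mul_sum]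
    refine Finset.sum_le_sum fun γ hγ => ?_
    simp only [cu]
    rw [norm_mul, mul_pow, mul_comm, Complex.norm_real, Real.norm_eq_abs, sq_abs, Real.sq_sqrt (by positivity)]
    have : (γ j : ℝ) ≤ M := by exact_mod_cast hle γ hγ
    gcongr
  have bD : ∫ x, ‖D x‖ ^ 2 ≤ 2 * ((M:ℝ)+1) * ∫ x, ‖f x‖ ^ 2 := by
    rw [hDn, hfn, Finset.mul_sum]
    refine (Finset.sum_le_sum_of_subset_of_nonneg (Finset.filter_subset _ s) fun _ _ _ => by positivity).trans ?_
    refine Finset.sum_le_sum fun γ hγ => ?_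
    simp only [cd]
    rw [norm_mul, mul_pow, mul_comm, Complex.norm_real, Real.norm_eq_abs, sq_abs, Real.sq_sqrt (by positivity)]
    have : (γ j : ℝ) ≤ M + 1 := by exact_mod_cast (hle γ hγ).trans (Nat.le_succ _)
    gcongr
  have key : ∀ V : EuclideanSpace ℝ (Fin n) → ℂ, (∀ x, ‖V x‖ ^ 2 ≤ (1/2) * ‖U x‖ ^ 2 + (1/2) * ‖D x‖ ^ 2) →
      ∫ x, ‖V x‖ ^ 2 ≤ 2 * ((M:ℝ)+1) * ∫ x, ‖f x‖ ^ 2 := by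
    intro V hV
    calc ∫ x, ‖V x‖ ^ 2 ≤ ∫ x, ((1/2) * ‖U x‖ ^ 2 + (1/2) * ‖D x‖ ^ 2) :=
          integral_mono_of_nonneg (Filter.Eventually.of_forall fun x => by positivity)
            ((iU.const_mul _).add (iD.const_mul _)) (Filter.Eventually.of_forall hV)
      _ = (1/2) * (∫ x, ‖U x‖ ^ 2) + (1/2) * ∫ x, ‖D x‖ ^ 2 := by
          rw [integral_add (iU.const_mul _) (iD.const_mul _), integral_const_mul, integral_const_mul]
      _ ≤ _ := by linarith
  refine ⟨⟨?_, key _ fun x => ?_⟩, ?_, key _ fun x => ?_⟩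
  · have : (fun x : EuclideanSpace ℝ (Fin n) => (x j : ℂ) * f x) = (1/2 : ℂ) • (U + D) := by
      funext x; rw [hX]; rfl
    rw [this]
    exact Submodule.smul_mem _ _ (Submodule.add_mem _ hUmem hDmem)
  · rw [hX, norm_mul, mul_pow]
    have := parallelogram_law_with_norm ℝ (U x) (D x)
    have h3 := mul_self_nonneg ‖U x - D x‖
    norm_num
    nlinarith
  · have : partialDerivE j f = (1/2 : ℂ) • (D - U) := by
      funext x; rw [hP]; rfl
    rw [this]
    exact Submodule.smul_mem _ _ (Submodule.sub_mem _ hDmem hUmem)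
  · rw [hP, norm_mul, mul_pow]
    have := parallelogram_law_with_norm ℝ (D x) (U x)
    have h3 := mul_self_nonneg ‖D x + U x‖
    norm_num
    nlinarith

/-- After `k` steps: membership in `E_{N+k}` with the accumulated bound. -/
def Q (n N : ℕ) (K : ℝ) (k : ℕ) (f : EuclideanSpace ℝ (Fin n) → ℂ) : Prop :=
  f ∈ hermiteSpan n (N + k) ∧ ∫ x, ‖f x‖ ^ 2 ≤ 2 ^ k * ((N+1).ascFactorial k : ℝ) * K

lemma Q_bound {N k : ℕ} {K a b : ℝ} (h : b ≤ 2 ^ k * ((N+1).ascFactorial k : ℝ) * K)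
    (h2 : a ≤ 2 * (((N+k : ℕ):ℝ)+1) * b) :
    a ≤ 2 ^ (k+1) * ((N+1).ascFactorial (k+1) : ℝ) * K := by
  refine h2.trans ((mul_le_mul_of_nonneg_left h (by positivity)).trans (le_of_eq ?_))
  rw [Nat.ascFactorial_succ]; push_cast; ring

lemma Q_x {n N : ℕ} {K : ℝ} {k : ℕ} {f : EuclideanSpace ℝ (Fin n) → ℂ} (h : Q n N K k f) (j : Fin n) :
    Q n N K (k+1) (fun x => (x j : ℂ) * f x) :=
  ⟨(step h.1 j).1.1, Q_bound h.2 (step h.1 j).1.2⟩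

lemma Q_d {n N : ℕ} {K : ℝ} {k : ℕ} {f : EuclideanSpace ℝ (Fin n) → ℂ} (h : Q n N K k f) (j : Fin n) :
    Q n N K (k+1) (partialDerivE j f) :=
  ⟨(step h.1 j).2.1, Q_bound h.2 (step h.1 j).2.2⟩

lemma Q_diter {n N : ℕ} {K : ℝ} {k : ℕ} {f : EuclideanSpace ℝ (Fin n) → ℂ} (h : Q n N K k f) (j : Fin n)
    (b : ℕ) : Q n N K (k+b) ((partialDerivE j)^[b] f) := by
  induction b with
  | zero => exact h
  | succ b ih => rw [Function.iterate_succ_apply']; exact Q_d ih j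

lemma Q_xiter {n N : ℕ} {K : ℝ} {k : ℕ} {f : EuclideanSpace ℝ (Fin n) → ℂ} (h : Q n N K k f) (j : Fin n)
    (b : ℕ) : Q n N K (k+b) (fun x => (x j : ℂ) ^ b * f x) := by
  induction b with
  | zero => simpa using h
  | succ b ih =>
    have := Q_x ih j
    simpa [pow_succ', mul_assoc, add_assoc] using this

lemma Q_fold {n N : ℕ} {K : ℝ} {k : ℕ} {f : EuclideanSpace ℝ (Fin n) → ℂ} (h : Q n N K k f)
    (β : Fin n → ℕ) (l : List (Fin n)) :
    Q n N K (k + (l.map β).sum) (l.foldr (fun j g => (partialDerivE j)^[β j] g) f) := by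
  induction l with
  | nil => simpa using h
  | cons j l ih =>
    have := Q_diter ih j (β j)
    simp only [List.map_cons, List.sum_cons, List.foldr_cons]
    convert this using 1
    omega

lemma Q_prod {n N : ℕ} {K : ℝ} {k : ℕ} {f : EuclideanSpace ℝ (Fin n) → ℂ} (h : Q n N K k f)
    (α : Fin n → ℕ) (s : Finset (Fin n)) :
    Q n N K (k + ∑ j ∈ s, α j) (fun x => (∏ j ∈ s, (x j : ℂ) ^ α j) * f x) := by
  induction s using Finset.induction_on with
  | empty => simpa using h
  | insert j s hj ih =>
    have := Q_xiter ih j (α j)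
    simp only [Finset.sum_insert hj, Finset.prod_insert hj, mul_assoc]
    convert this using 1
    omega

lemma real_bound (N k : ℕ) (δ : ℝ) (h0 : 0 < δ) :
    2 ^ k * ((N+1).ascFactorial k : ℝ) ≤
      (Real.exp (Real.exp 1 / (2 * δ ^ 2)) * (2 * δ) ^ k * (Nat.factorial k : ℝ) *
        Real.exp (δ⁻¹ * Real.sqrt N)) ^ 2 := by
  set A := Real.exp (δ⁻¹ * Real.sqrt N) with hA
  set B := Real.exp (Real.exp 1 / (2 * δ ^ 2)) with hB
  have hA1 : 1 ≤ A := Real.one_le_exp (by positivity)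
  have hB1 : 1 ≤ B := Real.one_le_exp (by positivity)
  have hA2 : 1 ≤ A ^ 2 := one_le_pow₀ hA1
  have hB2 : 1 ≤ B ^ 2 := one_le_pow₀ hB1
  rcases Nat.eq_zero_or_pos k with rfl | hk
  · simp only [pow_zero, Nat.ascFactorial_zero, Nat.factorial_zero, Nat.cast_one, mul_one]
    rw [mul_pow]; nlinarith
  set F : ℝ := (Nat.factorial k : ℝ) with hF
  have hFp : 0 < F := by positivity
  have hkp : (0:ℝ) < k := by exact_mod_cast hk
  have e1 : (N:ℝ) ^ k ≤ (δ ^ k * F) ^ 2 * A ^ 2 := by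
    have := Real.pow_div_factorial_le_exp (δ⁻¹ * Real.sqrt N) (by positivity) k
    rw [div_le_iff₀ (by positivity), ← hA, mul_pow, inv_pow, inv_mul_le_iff₀ (by positivity)] at this
    have h2 := pow_le_pow_left₀ (by positivity) this 2
    rw [← pow_mul, mul_comm k 2, pow_mul, Real.sq_sqrt (by positivity)] at h2
    refine h2.trans (le_of_eq ?_)
    ring
  have e2 : (k:ℝ) ^ k ≤ (δ ^ k * F) ^ 2 * B ^ 2 := by
    have s1 : (k:ℝ) ^ k ≤ F * Real.exp 1 ^ k := by
      have := Real.pow_div_factorial_le_exp (k:ℝ) hkp.le k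
      rw [div_le_iff₀ (by positivity)] at this
      rw [← Real.exp_nat_mul, mul_one]
      linarith
    have hBy : B ^ 2 = Real.exp (Real.exp 1 / δ ^ 2) := by
      rw [hB, ← Real.exp_nat_mul]; congr 1; push_cast; field_simp
    have s2 : (Real.exp 1 ^ 2) ^ k ≤ (δ ^ 2 * k) ^ k * B ^ 2 := by
      rw [hBy]
      set y := Real.exp 1 / δ ^ 2 with hy
      have hy' : Real.exp 1 = y * δ ^ 2 := by rw [hy]; field_simp
      have t : y / k * Real.exp 1 ≤ Real.exp (y / k) := by
        have := Real.add_one_le_exp (y / k - 1)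
        have h3 : Real.exp (y / k) = Real.exp (y/k - 1) * Real.exp 1 := by
          rw [← Real.exp_add]; ring_nf
        rw [h3]
        gcongr
        linarith
      have t2 := pow_le_pow_left₀ (by positivity) t k
      rw [← Real.exp_nat_mul, mul_div_cancel₀ _ hkp.ne'] at t2
      refine le_trans (le_of_eq ?_) (mul_le_mul_of_nonneg_left t2 (by positivity))
      rw [← mul_pow]
      congr 1
      have : y * δ ^ 2 = Real.exp 1 := hy'.symm
      have h4 : δ ^ 2 * k * (y / k * Real.exp 1) = (y * δ ^ 2) * Real.exp 1 := by
        field_simp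
      rw [h4, this, sq]
    have s3 : (k:ℝ) ^ k * (k:ℝ) ^ k ≤ (k:ℝ) ^ k * ((δ ^ k * F) ^ 2 * B ^ 2) := by
      calc (k:ℝ) ^ k * (k:ℝ) ^ k ≤ (F * Real.exp 1 ^ k) * (F * Real.exp 1 ^ k) := by gcongr
        _ = F ^ 2 * (Real.exp 1 ^ 2) ^ k := by ring
        _ ≤ F ^ 2 * ((δ ^ 2 * k) ^ k * B ^ 2) := by gcongr
        _ = _ := by ring
    exact le_of_mul_le_mul_left s3 (by positivity)
  have e3 : ((N+1).ascFactorial k : ℝ) ≤ ((N:ℝ) + k) ^ k := by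
    exact_mod_cast Nat.ascFactorial_le_pow_add N k
  have e4 := add_pow_le (Nat.cast_nonneg (α := ℝ) N) hkp.le k
  have e5 : (2:ℝ) ^ k = 2 * 2 ^ (k-1) := by
    rw [← pow_succ', Nat.sub_add_cancel hk]
  have e6 : A ^ 2 + B ^ 2 ≤ 2 * (A ^ 2 * B ^ 2) := by nlinarith
  calc 2 ^ k * ((N+1).ascFactorial k : ℝ) ≤ 2 ^ k * (2 ^ (k-1) * ((N:ℝ) ^ k + (k:ℝ) ^ k)) := by
        gcongr; exact e3.trans e4
    _ ≤ 2 ^ k * (2 ^ (k-1) * ((δ ^ k * F) ^ 2 * A ^ 2 + (δ ^ k * F) ^ 2 * B ^ 2)) := by gcongr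
    _ = 2 ^ k * 2 ^ (k-1) * (δ ^ k * F) ^ 2 * (A ^ 2 + B ^ 2) := by ring
    _ ≤ 2 ^ k * 2 ^ (k-1) * (δ ^ k * F) ^ 2 * (2 * (A ^ 2 * B ^ 2)) := by gcongr
    _ = 2 ^ k * (2 * 2 ^ (k-1)) * (δ ^ k * F) ^ 2 * (A ^ 2 * B ^ 2) := by ring
    _ = _ := by rw [← e5]; ring

end HWB

/-- **Weighted Bernstein-type estimates for finite combinations of Hermite functions.**
For every `N ∈ ℕ`, `f ∈ E_N`, `0 < δ ≤ 1` and multi-indices `α, β ∈ ℕⁿ`,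
`‖x^α ∂_x^β f‖_{L²(ℝⁿ)} ≤ e^{e/(2δ²)} (2δ)^{|α|+|β|} (|α|+|β|)! e^{δ⁻¹ √N} ‖f‖_{L²(ℝⁿ)}`. -/
theorem hermite_weighted_bernstein (n : ℕ) (hn : 1 ≤ n) (N : ℕ)
    (f : EuclideanSpace ℝ (Fin n) → ℂ) (hf : f ∈ hermiteSpan n N)
    (δ : ℝ) (hδ0 : 0 < δ) (hδ1 : δ ≤ 1) (α β : Fin n → ℕ) :
    Real.sqrt (∫ x, ‖(∏ j, ((x j : ℝ) : ℂ) ^ α j) * multiDerivE β f x‖ ^ 2) ≤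
      Real.exp (Real.exp 1 / (2 * δ ^ 2)) * (2 * δ) ^ ((∑ j, α j) + ∑ j, β j) *
        (Nat.factorial ((∑ j, α j) + ∑ j, β j) : ℝ) * Real.exp (δ⁻¹ * Real.sqrt N) *
        Real.sqrt (∫ x, ‖f x‖ ^ 2) := by
  have hQ0 : HWB.Q n N (∫ x, ‖f x‖ ^ 2) 0 f := ⟨hf, by simp⟩
  have hQ := (HWB.Q_prod (HWB.Q_fold hQ0 β (List.finRange n)) α Finset.univ).2
  have hk : 0 + ((List.finRange n).map β).sum + ∑ j, α j = (∑ j, α j) + ∑ j, β j := by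
    rw [zero_add, add_comm, ← List.ofFn_eq_map, List.sum_ofFn]
  rw [hk] at hQ
  have hI : 0 ≤ ∫ x, ‖f x‖ ^ 2 := integral_nonneg fun x => by positivity
  refine Real.sqrt_le_iff.2 ⟨by positivity, ?_⟩
  rw [mul_pow, Real.sq_sqrt hI]
  exact hQ.trans (mul_le_mul_of_nonneg_right (HWB.real_bound N _ δ hδ0) hI)
end

section
/- Let n ≥ 1, R > 0 and let ω ⊂ ℝⁿ be a measurable subset with |ω ∩ B(0,R)| > 0, where B(0,R) is the open Euclidean ball centered at 0 of radius R. Then for every complex polynomial function P ∈ ℂ[X₁,...,X_n] of degree d, ‖P‖_{L²(B(0,R))} ≤ (2^{2d+1}/√3) · √(4|B(0,R)| / |ω ∩ B(0,R)|) · ((1 + (1 − |ω ∩ B(0,R)|/(4|B(0,R)|))^{1/n}) / (1 − (1 − |ω ∩ B(0,R)|/(4|B(0,R)|))^{1/n}))^d · ‖P‖_{L²(ω ∩ B(0,R))}. -/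
open MeasureTheory

lemma rz_points (δ : ℝ) (hδ : 0 ≤ δ) (k : ℕ) : ∀ (E : Set ℝ), IsCompact E →
    ENNReal.ofReal (k * δ) < volume E →
    ∃ y : ℕ → ℝ, (∀ i ≤ k, y i ∈ E) ∧ (∀ i < k, y i + δ ≤ y (i + 1)) := by
  induction k with
  | zero =>
    intro E hE h
    have hne : E.Nonempty := nonempty_of_measure_ne_zero (ne_of_gt (lt_of_le_of_lt (zero_le) h))
    obtain ⟨x, hx⟩ := hne
    exact ⟨fun _ => x, fun _ _ => hx, fun i hi => absurd hi (by omega)⟩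
  | succ k ih =>
    intro E hE h
    have hne : E.Nonempty := nonempty_of_measure_ne_zero (ne_of_gt (lt_of_le_of_lt (zero_le) h))
    have hmin := hE.sInf_mem hne
    set a := sInf E with ha
    have hlb : ∀ x ∈ E, a ≤ x := fun x hx => csInf_le hE.bddBelow hx
    obtain ⟨y, hy1, hy2⟩ := ih (E ∩ Set.Ici (a + δ)) (hE.inter_right isClosed_Ici) (by
      have h1 : volume E ≤ volume (E ∩ Set.Ici (a + δ)) + ENNReal.ofReal δ := by
        calc volume E ≤ volume ((E ∩ Set.Ici (a + δ)) ∪ Set.Ico a (a + δ)) := by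
              apply measure_mono
              intro x hx
              by_cases hc : a + δ ≤ x
              · exact Or.inl ⟨hx, hc⟩
              · exact Or.inr ⟨hlb x hx, not_le.1 hc⟩
          _ ≤ _ := measure_union_le _ _
          _ = _ := by simp
      have h2 : ENNReal.ofReal ((k+1 : ℕ) * δ) = ENNReal.ofReal (k * δ) + ENNReal.ofReal δ := by
        rw [← ENNReal.ofReal_add (by positivity) hδ]; congr 1; push_cast; ring
      rw [h2] at h
      exact lt_of_add_lt_add_right (h.trans_le h1))
    refine ⟨fun i => if i = 0 then a else y (i - 1), ?_, ?_⟩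
    · intro i hi
      rcases i with _ | i
      · simpa using hmin
      · simpa using (hy1 i (by omega)).1
    · intro i hi
      rcases i with _ | i
      · simpa using (hy1 0 (by omega)).2
      · simpa using hy2 i (by omega)

lemma rz_prod (d i : ℕ) (hi : i ≤ d) :
    ∏ j ∈ (Finset.range (d + 1)).erase i, |(i : ℝ) - j| = (i.factorial : ℝ) * (d - i).factorial := by
  have h : (Finset.range (d+1)).erase i = Finset.range i ∪ Finset.Ico (i+1) (d+1) := by
    ext j; simp; omega
  have hdisj : Disjoint (Finset.range i) (Finset.Ico (i+1) (d+1)) := by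
    rw [Finset.disjoint_left]; intro j; simp; omega
  rw [h, Finset.prod_union hdisj]
  congr 1
  · rw [← Finset.prod_range_reflect, ← Finset.prod_range_add_one_eq_factorial]
    push_cast
    apply Finset.prod_congr rfl
    intro j hj
    have hj := Finset.mem_range.1 hj
    rw [Nat.sub_sub, Nat.cast_sub (by omega)]
    push_cast
    rw [show (i : ℝ) - (i - (1 + j)) = j + 1 by ring, abs_of_pos (by positivity)]
  · rw [Finset.prod_Ico_eq_prod_range, ← Finset.prod_range_add_one_eq_factorial,
      show d + 1 - (i + 1) = d - i by omega]
    push_cast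
    apply Finset.prod_congr rfl
    intro j hj
    rw [show (i : ℝ) - (i + 1 + j) = -(j + 1) by ring, abs_neg, abs_of_pos (by positivity)]

lemma rz_gap (δ : ℝ) (d : ℕ) (y : ℕ → ℝ) (hy : ∀ i < d, y i + δ ≤ y (i + 1))
    (i k : ℕ) (h : i + k ≤ d) : y i + k * δ ≤ y (i + k) := by
  induction k with
  | zero => simp
  | succ k ih =>
    have := ih (by omega)
    have h2 := hy (i+k) (by omega)
    rw [← add_assoc]; push_cast; linarith

lemma rz_gap' (δ : ℝ) (hδ : 0 ≤ δ) (d : ℕ) (y : ℕ → ℝ) (hy : ∀ i < d, y i + δ ≤ y (i + 1))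
    (i j : ℕ) (hi : i ≤ d) (hj : j ≤ d) : |(i : ℝ) - j| * δ ≤ |y i - y j| := by
  rcases le_total i j with h | h
  · obtain ⟨k, rfl⟩ := Nat.exists_eq_add_of_le h
    have := rz_gap δ d y hy i k hj
    push_cast
    rw [show (i : ℝ) - (i + k) = -k by ring, abs_neg, abs_of_nonneg (by positivity), abs_sub_comm]
    exact le_trans (by linarith) (le_abs_self _)
  · obtain ⟨k, rfl⟩ := Nat.exists_eq_add_of_le h
    have := rz_gap δ d y hy j k hi
    push_cast
    rw [show (j : ℝ) + k - j = k by ring, abs_of_nonneg (by positivity)]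
    exact le_trans (by linarith) (le_abs_self _)

/-- one dimensional Remez-type bound at the endpoint -/
lemma rz_one (q : Polynomial ℂ) (d : ℕ) (hq : q.natDegree ≤ d) (l σ c : ℝ) (hl : 0 < l)
    (hσ : 0 < σ)
    (hE : ENNReal.ofReal (σ * l) < volume {r : ℝ | r ∈ Set.Icc 0 l ∧ ‖q.eval (r : ℂ)‖ ≤ c}) :
    ‖q.eval 0‖ ≤ (6 / σ) ^ d * c := by
  have hcomp : IsCompact {r : ℝ | r ∈ Set.Icc 0 l ∧ ‖q.eval (r : ℂ)‖ ≤ c} := by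
    apply isCompact_Icc.inter_right (s := Set.Icc (0:ℝ) l)
    exact isClosed_le (f := fun r : ℝ => ‖q.eval (r : ℂ)‖)
      ((q.continuous.comp Complex.continuous_ofReal).norm) continuous_const
  rcases Nat.eq_zero_or_pos d with rfl | hd
  · obtain ⟨y, hy, -⟩ := rz_points 0 le_rfl 0 _ hcomp
      (lt_of_le_of_lt (by simp) hE)
    have h0 := (hy 0 le_rfl).2
    rw [Polynomial.eq_C_of_natDegree_le_zero hq] at h0 ⊢
    simpa using h0
  have hd' : (0:ℝ) < d := by exact_mod_cast hd
  set δ := σ * l / d with hδd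
  have hδ : 0 < δ := by positivity
  obtain ⟨y, hyE, hyg⟩ := rz_points δ hδ.le d _ hcomp (by
    rwa [show (d:ℝ) * δ = σ * l by rw [hδd]; field_simp])
  have hgap := rz_gap' δ hδ.le d y hyg
  have hc : 0 ≤ c := (norm_nonneg _).trans (hyE 0 (by omega)).2
  have hinj : Set.InjOn (fun i => (y i : ℂ)) (Finset.range (d+1) : Set ℕ) := by
    intro i hi j hj hij
    simp only [Finset.coe_range, Set.mem_Iio] at hi hj
    have hij : y i = y j := Complex.ofReal_injective hij
    have := hgap i j (by omega) (by omega)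
    rw [hij, sub_self, abs_zero] at this
    have h3 : |(i:ℝ) - j| ≤ 0 := by
      by_contra hcon
      push Not at hcon
      nlinarith
    have := abs_nonpos_iff.1 h3
    exact_mod_cast sub_eq_zero.1 this
  have hint := Lagrange.eq_interpolate (f := q) hinj (by
    rw [Finset.card_range]
    exact lt_of_le_of_lt (Polynomial.degree_le_of_natDegree_le hq) (by exact_mod_cast Nat.lt_succ_self d))
  have hbasis : ∀ i ∈ Finset.range (d+1),
      ‖(Lagrange.basis (Finset.range (d+1)) (fun i => (y i : ℂ)) i).eval 0‖ ≤
        (l/δ)^d * (1 / ((i.factorial : ℝ) * (d - i).factorial)) := by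
    intro i hi
    have hi' := Finset.mem_range.1 hi
    rw [Lagrange.basis, Polynomial.eval_prod, norm_prod, ← rz_prod d i (by omega), one_div,
      ← Finset.prod_inv_distrib]
    have hcard : ((Finset.range (d+1)).erase i).card = d := by
      rw [Finset.card_erase_of_mem hi]; simp
    rw [show (l/δ)^d = ∏ j ∈ (Finset.range (d+1)).erase i, (l/δ) by
      rw [Finset.prod_const, hcard], ← Finset.prod_mul_distrib]
    apply Finset.prod_le_prod (fun _ _ => norm_nonneg _)
    intro j hj
    obtain ⟨hji, hj⟩ := Finset.mem_erase.1 hj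
    have hj' := Finset.mem_range.1 hj
    have hyj := (hyE j (by omega)).1
    have hg := hgap i j (by omega) (by omega)
    have hpos : 0 < |(i:ℝ) - j| := by
      rw [abs_pos, sub_ne_zero]; exact fun h => hji (Nat.cast_injective h).symm
    simp only [Lagrange.basisDivisor, Polynomial.eval_mul, Polynomial.eval_C, Polynomial.eval_sub,
      Polynomial.eval_X, norm_mul, norm_inv, zero_sub, norm_neg]
    rw [← Complex.ofReal_sub, Complex.norm_real, Complex.norm_real, Real.norm_eq_abs, Real.norm_eq_abs,
      abs_of_nonneg hyj.1]
    calc |y i - y j|⁻¹ * y j ≤ (|(i:ℝ) - j| * δ)⁻¹ * l := by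
          have := hyj.1
          gcongr
          exact hyj.2
      _ = _ := by rw [mul_inv]; ring
  have hfinal : (l/δ)^d * (2^d / d.factorial) ≤ (6/σ)^d := by
    have e1 : l / δ = d / σ := by rw [hδd]; field_simp
    rw [e1, div_pow, div_pow]
    have h1 := Real.pow_div_factorial_le_exp (d:ℝ) hd'.le d
    have h2 : Real.exp d ≤ 3 ^ d := by
      rw [← Real.exp_one_pow]
      gcongr
      exact Real.exp_one_lt_three.le
    calc (d:ℝ)^d / σ^d * (2^d / d.factorial) = 2^d * ((d:ℝ)^d / d.factorial) / σ^d := by ring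
      _ ≤ 2^d * 3^d / σ^d := by gcongr; exact h1.trans h2
      _ = 6^d / σ^d := by rw [← mul_pow]; norm_num
  calc ‖q.eval 0‖ = ‖∑ i ∈ Finset.range (d+1), q.eval (y i : ℂ) *
        (Lagrange.basis (Finset.range (d+1)) (fun i => (y i : ℂ)) i).eval 0‖ := by
        conv_lhs => rw [hint]
        rw [Lagrange.interpolate_apply, Polynomial.eval_finsetSum]
        simp
    _ ≤ ∑ i ∈ Finset.range (d+1), c * ((l/δ)^d * (1 / ((i.factorial : ℝ) * (d - i).factorial))) := by
        refine (norm_sum_le _ _).trans (Finset.sum_le_sum fun i hi => ?_)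
        rw [norm_mul]
        have := (hyE i (by have := Finset.mem_range.1 hi; omega)).2
        gcongr
        exact hbasis i hi
    _ = c * ((l/δ)^d * (2^d / d.factorial)) := by
        rw [← Finset.mul_sum, ← Finset.mul_sum]
        congr 2
        rw [← Nat.cast_ofNat (R := ℝ) (n := 2), ← Nat.cast_pow, ← Nat.sum_range_choose, Nat.cast_sum, Finset.sum_div]
        apply Finset.sum_congr rfl
        intro i hi
        rw [Nat.cast_choose ℝ (by have := Finset.mem_range.1 hi; omega)]
        field_simp
    _ ≤ c * (6/σ)^d := by gcongr
    _ = _ := mul_comm _ _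

lemma rz_bathtub (k : ℕ) (l σ : ℝ) (hl : 0 < l) (hσ1 : σ ≤ 1) (S : Set ℝ)
    (hS : MeasurableSet S) (hSl : S ⊆ Set.Ioc 0 l) (hvol : volume S ≤ ENNReal.ofReal (σ * l)) :
    ∫⁻ r in S, ENNReal.ofReal (r ^ k) ≤
      ∫⁻ r in Set.Ioc ((1 - σ) * l) l, ENNReal.ofReal (r ^ k) := by
  set c := (1 - σ) * l with hc
  have hc0 : 0 ≤ c := mul_nonneg (by linarith) hl.le
  set H := Set.Ioc c l with hH
  have hHm : MeasurableSet H := measurableSet_Ioc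
  have hHv : volume H = ENNReal.ofReal (σ * l) := by
    rw [hH, Real.volume_Ioc]; congr 1; rw [hc]; ring
  rw [← lintegral_inter_add_sdiff _ S hHm, ← lintegral_inter_add_sdiff _ H hS, Set.inter_comm H S]
  gcongr 1
  have hv : volume (S \ H) ≤ volume (H \ S) := by
    have h1 := measure_inter_add_sdiff (μ := volume) S hHm
    have h2 := measure_inter_add_sdiff (μ := volume) H hS
    rw [Set.inter_comm] at h2
    have hfin : volume (S ∩ H) ≠ ⊤ := by
      refine ne_top_of_le_ne_top ?_ (measure_mono Set.inter_subset_right)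
      rw [hHv]; exact ENNReal.ofReal_ne_top
    rw [← hHv, ← h1, ← h2] at hvol
    exact (ENNReal.add_le_add_iff_left hfin).1 hvol
  calc ∫⁻ r in S \ H, ENNReal.ofReal (r ^ k) ≤ ∫⁻ r in S \ H, ENNReal.ofReal (c ^ k) := by
        apply setLIntegral_mono measurable_const
        intro r hr
        have h1 := hSl hr.1
        have h2 : r ≤ c := by
          by_contra hcon
          exact hr.2 ⟨not_le.1 hcon, h1.2⟩
        have := h1.1.le
        gcongr
    _ = ENNReal.ofReal (c ^ k) * volume (S \ H) := by simp
    _ ≤ ENNReal.ofReal (c ^ k) * volume (H \ S) := by gcongr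
    _ = ∫⁻ r in H \ S, ENNReal.ofReal (c ^ k) := by simp
    _ ≤ _ := by
        apply setLIntegral_mono (by fun_prop)
        intro r hr
        have := hr.1.1.le
        gcongr

lemma rz_lint (k : ℕ) (a b : ℝ) (ha : 0 ≤ a) (hab : a ≤ b) :
    ∫⁻ r in Set.Ioc a b, ENNReal.ofReal (r ^ k) =
      ENNReal.ofReal ((b ^ (k + 1) - a ^ (k + 1)) / (k + 1)) := by
  rw [← ofReal_integral_eq_lintegral_ofReal (intervalIntegral.intervalIntegrable_pow _).1,
    ← intervalIntegral.integral_of_le hab]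
  · simp
  · filter_upwards [ae_restrict_mem measurableSet_Ioc] with y hy
    exact pow_nonneg (ha.trans hy.1.le) _

/-- ray lemma: weighted measure large implies Lebesgue measure large -/
lemma rz_ray (k : ℕ) (l σ s : ℝ) (hl : 0 < l) (hσ0 : 0 ≤ σ) (hσ1 : σ ≤ 1)
    (hs : 1 - (1 - σ) ^ (k + 1) = s) (S B : Set ℝ)
    (hS : MeasurableSet S) (hSl : S ⊆ Set.Ioc 0 l) (hB : Set.Ioo 0 l ⊆ B)
    (h : ENNReal.ofReal s * ∫⁻ r in B, ENNReal.ofReal (r ^ k) <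
      ∫⁻ r in S, ENNReal.ofReal (r ^ k)) :
    ENNReal.ofReal (σ * l) < volume S := by
  by_contra hcon
  have h1 := rz_bathtub k l σ hl hσ1 S hS hSl (not_lt.1 hcon)
  have hs0 : 0 ≤ s := by
    rw [← hs, sub_nonneg]; exact pow_le_one₀ (by linarith) (by linarith)
  refine absurd (h.trans_le h1) (not_lt.2 ?_)
  calc _ = ENNReal.ofReal s * ∫⁻ r in Set.Ioc 0 l, ENNReal.ofReal (r ^ k) := by
        rw [rz_lint k _ _ (mul_nonneg (by linarith) hl.le) (by nlinarith), rz_lint k _ _ le_rfl hl.le,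
          ← ENNReal.ofReal_mul hs0]
        congr 1
        rw [← hs, mul_pow]; simp; ring
    _ = ENNReal.ofReal s * ∫⁻ r in Set.Ioo 0 l, ENNReal.ofReal (r ^ k) := by
        rw [setLIntegral_congr Ioo_ae_eq_Ioc]
    _ ≤ _ := by
        gcongr

lemma rz_polar {E : Type*} [NormedAddCommGroup E] [NormedSpace ℝ E] [FiniteDimensional ℝ E]
    [Nontrivial E] [MeasurableSpace E] [BorelSpace E] (μ : Measure E) [μ.IsAddHaarMeasure]
    (A : Set E) (hA : MeasurableSet A) :
    μ A = ∫⁻ θ : Metric.sphere (0 : E) 1,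
      (∫⁻ r in {r : ℝ | 0 < r ∧ r • (θ : E) ∈ A}, ENNReal.ofReal (r ^ (Module.finrank ℝ E - 1)))
        ∂(μ.toSphere) := by
  have hmp := μ.measurePreserving_homeomorphUnitSphereProd
  have h0 : μ A = μ (A \ {0}) := (measure_sdiff_null (measure_singleton _)).symm
  have h1 : μ (A \ {0}) = μ.comap ((↑) : ({0}ᶜ : Set E) → E) ((↑) ⁻¹' A) := by
    rw [comap_subtype_coe_apply (measurableSet_singleton _).compl, Subtype.image_preimage_coe,
      Set.inter_comm]; rfl
  have hmeas : MeasurableSet ((fun p : Metric.sphere (0:E) 1 × Set.Ioi (0:ℝ) => (p.2 : ℝ) • (p.1 : E)) ⁻¹' A) := by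
    apply hA.preimage
    fun_prop
  have h2 : ((↑) : ({0}ᶜ : Set E) → E) ⁻¹' A = (homeomorphUnitSphereProd E) ⁻¹'
      ((fun p : Metric.sphere (0:E) 1 × Set.Ioi (0:ℝ) => (p.2 : ℝ) • (p.1 : E)) ⁻¹' A) := by
    ext x
    have hx : ‖(x : E)‖ ≠ 0 := norm_ne_zero_iff.2 x.2
    simp [smul_smul, hx]
  rw [h0, h1, h2, hmp.measure_preimage hmeas.nullMeasurableSet, Measure.prod_apply hmeas]
  apply lintegral_congr
  intro θ
  rw [Measure.volumeIoiPow, withDensity_apply _ (measurable_prodMk_left hmeas),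
    setLIntegral_subtype measurableSet_Ioi _ fun a : ℝ ↦ .ofReal (a ^ _)]
  congr 2
  ext r
  simp [and_comm]

lemma rz_line {n : ℕ} (P : MvPolynomial (Fin n) ℂ) (x θ : Fin n → ℝ) :
    ∃ q : Polynomial ℂ, q.natDegree ≤ P.totalDegree ∧ ∀ r : ℝ,
      q.eval (r : ℂ) = MvPolynomial.eval (fun j => ((x j + r * θ j : ℝ) : ℂ)) P := by
  refine ⟨MvPolynomial.aeval (fun j => Polynomial.C (θ j : ℂ) * Polynomial.X + Polynomial.C (x j : ℂ)) P, ?_, ?_⟩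
  · simpa using MvPolynomial.aeval_natDegree_le P le_rfl _ (n := 1) (fun i => Polynomial.natDegree_linear_le)
  · intro r
    rw [MvPolynomial.aeval_def, ← Polynomial.coe_evalRingHom, MvPolynomial.hom_eval₂,
      ← MvPolynomial.coe_eval₂Hom, MvPolynomial.eval]
    congr 2
    · ext; simp
    · funext j; simp; ring

lemma rz_cont {n : ℕ} (P : MvPolynomial (Fin n) ℂ) :
    Continuous (fun x : EuclideanSpace ℝ (Fin n) => MvPolynomial.eval (fun j => ((x j : ℝ) : ℂ)) P) := by
  apply (MvPolynomial.continuous_eval P).comp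
  fun_prop

lemma rz_remez {n : ℕ} (hn : 1 ≤ n) (R : ℝ) (P : MvPolynomial (Fin n) ℂ)
    (x₀ : EuclideanSpace ℝ (Fin n)) (hx₀ : x₀ ∈ Metric.ball (0 : EuclideanSpace ℝ (Fin n)) R)
    (σ s c : ℝ) (hσ0 : 0 < σ) (hσ1 : σ ≤ 1) (hs : 1 - (1 - σ) ^ n = s)
    (h : ENNReal.ofReal s * volume (Metric.ball (0 : EuclideanSpace ℝ (Fin n)) R) <
      volume {x ∈ Metric.ball (0 : EuclideanSpace ℝ (Fin n)) R |
        ‖MvPolynomial.eval (fun j => ((x j : ℝ) : ℂ)) P‖ ≤ c}) :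
    ‖MvPolynomial.eval (fun j => ((x₀ j : ℝ) : ℂ)) P‖ ≤ (6 / σ) ^ P.totalDegree * c := by
  have : Nonempty (Fin n) := ⟨⟨0, hn⟩⟩
  set B := Metric.ball (0 : EuclideanSpace ℝ (Fin n)) R with hB
  set A := {x ∈ B | ‖MvPolynomial.eval (fun j => ((x j : ℝ) : ℂ)) P‖ ≤ c} with hA
  have hBm : MeasurableSet B := measurableSet_ball
  have hAm : MeasurableSet A :=
    hBm.inter (measurableSet_le (rz_cont P).norm.measurable measurable_const)
  have htm : Measurable (fun x : EuclideanSpace ℝ (Fin n) => x₀ + x) := by fun_prop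
  rw [← measure_preimage_add volume x₀ A, ← measure_preimage_add volume x₀ B,
    rz_polar volume _ (htm hAm), rz_polar volume _ (htm hBm)] at h
  have hex : ∃ θ : Metric.sphere (0 : EuclideanSpace ℝ (Fin n)) 1,
      ENNReal.ofReal s * (∫⁻ r in {r : ℝ | 0 < r ∧ r • (θ : EuclideanSpace ℝ (Fin n)) ∈
        (fun x => x₀ + x) ⁻¹' B},
        ENNReal.ofReal (r ^ (Module.finrank ℝ (EuclideanSpace ℝ (Fin n)) - 1))) <
      ∫⁻ r in {r : ℝ | 0 < r ∧ r • (θ : EuclideanSpace ℝ (Fin n)) ∈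
        (fun x => x₀ + x) ⁻¹' A},
        ENNReal.ofReal (r ^ (Module.finrank ℝ (EuclideanSpace ℝ (Fin n)) - 1)) := by
    by_contra hcon
    push Not at hcon
    refine absurd h (not_lt.2 ?_)
    rw [← lintegral_const_mul' _ _ ENNReal.ofReal_ne_top]
    exact lintegral_mono hcon
  obtain ⟨θ, hθ⟩ := hex
  have hθn : ‖(θ : EuclideanSpace ℝ (Fin n))‖ = 1 := by simp
  rw [finrank_euclideanSpace_fin] at hθ
  set BT : Set ℝ := {r : ℝ | 0 < r ∧ r • (θ : EuclideanSpace ℝ (Fin n)) ∈ (fun x => x₀ + x) ⁻¹' B}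
    with hBT
  set AT : Set ℝ := {r : ℝ | 0 < r ∧ r • (θ : EuclideanSpace ℝ (Fin n)) ∈ (fun x => x₀ + x) ⁻¹' A}
    with hAT
  have hATB : AT ⊆ BT := fun r hr => ⟨hr.1, hr.2.1⟩
  have hATm : MeasurableSet AT := by
    apply MeasurableSet.inter measurableSet_Ioi
    have : Measurable (fun r : ℝ => x₀ + r • (θ : EuclideanSpace ℝ (Fin n))) := by fun_prop
    exact this hAm
  have hATne : AT.Nonempty := by
    by_contra hcon
    rw [Set.not_nonempty_iff_eq_empty] at hcon
    rw [hcon] at hθ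
    simp at hθ
  have hbdd : BddAbove BT := by
    refine ⟨R + ‖x₀‖, ?_⟩
    rintro r ⟨hr, hrB⟩
    have h1 : ‖x₀ + r • (θ : EuclideanSpace ℝ (Fin n))‖ < R := mem_ball_zero_iff.1 hrB
    have h2 : ‖r • (θ : EuclideanSpace ℝ (Fin n))‖ = r := by
      rw [norm_smul, hθn, mul_one, Real.norm_of_nonneg hr.le]
    have h3 := norm_sub_le (x₀ + r • (θ : EuclideanSpace ℝ (Fin n))) x₀
    rw [add_sub_cancel_left, h2] at h3
    linarith
  set l := sSup BT with hl
  have hBTl : BT ⊆ Set.Ioc 0 l := fun r hr => ⟨hr.1, le_csSup hbdd hr⟩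
  have hlpos : 0 < l := by
    obtain ⟨r, hr⟩ := hATne
    have := hBTl (hATB hr)
    exact this.1.trans_le this.2
  have hIoo : Set.Ioo 0 l ⊆ BT := by
    intro r hr
    obtain ⟨b, hb, hrb⟩ := exists_lt_of_lt_csSup (hATne.mono hATB) hr.2
    refine ⟨hr.1, ?_⟩
    have hb0 := hb.1
    have hconv := (convex_ball (0 : EuclideanSpace ℝ (Fin n)) R) hx₀ hb.2
      (a := 1 - r / b) (b := r / b)
      (by rw [sub_nonneg, div_le_one hb0]; exact hrb.le) (div_nonneg hr.1.le hb0.le) (by ring)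
    show x₀ + r • (θ : EuclideanSpace ℝ (Fin n)) ∈ B
    convert hconv using 1
    simp only [smul_add, smul_smul, sub_smul, one_smul]
    rw [div_mul_cancel₀ _ hb0.ne']
    abel
  have hray := rz_ray (n - 1) l σ s hlpos hσ0.le hσ1 (by rw [Nat.sub_add_cancel hn]; exact hs) AT BT
    hATm (hATB.trans hBTl) hIoo hθ
  obtain ⟨q, hqd, hq⟩ := rz_line P (fun j => x₀ j) (fun j => (θ : EuclideanSpace ℝ (Fin n)) j)
  have hone := rz_one q P.totalDegree hqd l σ c hlpos hσ0 (hray.trans_le (measure_mono (by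
    intro r hr
    have h1 := hBTl (hATB hr)
    refine ⟨⟨h1.1.le, h1.2⟩, ?_⟩
    rw [hq]
    have := hr.2.2
    simpa using this)))
  have h0 := hq 0
  simp at h0
  rwa [h0] at hone

set_option maxHeartbeats 2000000 in
/-- **`L²` Remez-type inequality on a ball.** Let `n ≥ 1`, `R > 0` and let `ω ⊂ ℝⁿ` be
measurable with `|ω ∩ B(0,R)| > 0`. Then for every complex polynomial `P` of degree `d`,
`‖P‖_{L²(B(0,R))} ≤ (2^{2d+1}/√3) √(4|B(0,R)|/|ω ∩ B(0,R)|)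
  ((1+(1-|ω∩B(0,R)|/(4|B(0,R)|))^{1/n})/(1-(1-|ω∩B(0,R)|/(4|B(0,R)|))^{1/n}))^d
  ‖P‖_{L²(ω ∩ B(0,R))}`. -/
theorem remez_L2_ball (n : ℕ) (hn : 1 ≤ n) (R : ℝ) (hR : 0 < R)
    (ω : Set (EuclideanSpace ℝ (Fin n))) (hω : MeasurableSet ω)
    (hpos : 0 < volume (ω ∩ Metric.ball (0 : EuclideanSpace ℝ (Fin n)) R))
    (P : MvPolynomial (Fin n) ℂ) (d : ℕ) (hd : P.totalDegree = d)
    (m M : ℝ)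
    (hm : m = (volume (ω ∩ Metric.ball (0 : EuclideanSpace ℝ (Fin n)) R)).toReal)
    (hM : M = (volume (Metric.ball (0 : EuclideanSpace ℝ (Fin n)) R)).toReal) :
    Real.sqrt (∫ x in Metric.ball (0 : EuclideanSpace ℝ (Fin n)) R,
        ‖MvPolynomial.eval (fun j => ((x j : ℝ) : ℂ)) P‖ ^ 2) ≤
      2 ^ (2 * d + 1) / Real.sqrt 3 * Real.sqrt (4 * M / m) *
        ((1 + (1 - m / (4 * M)) ^ ((1 : ℝ) / n)) /
          (1 - (1 - m / (4 * M)) ^ ((1 : ℝ) / n))) ^ d *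
        Real.sqrt (∫ x in ω ∩ Metric.ball (0 : EuclideanSpace ℝ (Fin n)) R,
          ‖MvPolynomial.eval (fun j => ((x j : ℝ) : ℂ)) P‖ ^ 2) := by
  set B := Metric.ball (0 : EuclideanSpace ℝ (Fin n)) R with hB
  set W := ω ∩ B with hW
  set f : EuclideanSpace ℝ (Fin n) → ℝ :=
    fun x => ‖MvPolynomial.eval (fun j => ((x j : ℝ) : ℂ)) P‖ with hf
  have hfc : Continuous f := (rz_cont P).norm
  have hf0 : ∀ x, 0 ≤ f x := fun x => norm_nonneg _
  have hBm : MeasurableSet B := measurableSet_ball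
  have hWm : MeasurableSet W := hω.inter hBm
  have hWB : W ⊆ B := Set.inter_subset_right
  have hBfin : volume B ≠ ⊤ := measure_ball_lt_top.ne
  have hWfin : volume W ≠ ⊤ := ne_top_of_le_ne_top hBfin (measure_mono hWB)
  have hm0 : 0 < m := hm ▸ ENNReal.toReal_pos hpos.ne' hWfin
  have hmM : m ≤ M := by
    rw [hm, hM]; exact ENNReal.toReal_mono hBfin (measure_mono hWB)
  have hM0 : 0 < M := hm0.trans_le hmM
  have hintB : IntegrableOn (fun x => f x ^ 2) B := by
    have : IntegrableOn (fun x => f x ^ 2) (Metric.closedBall (0 : EuclideanSpace ℝ (Fin n)) R) :=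
      (hfc.pow 2).continuousOn.integrableOn_compact (isCompact_closedBall _ _)
    exact this.mono_set Metric.ball_subset_closedBall
  have hintW : IntegrableOn (fun x => f x ^ 2) W := hintB.mono_set hWB
  set I := ∫ x in W, f x ^ 2 with hI
  have hI0 : 0 ≤ I := integral_nonneg fun x => sq_nonneg _
  set s := m / (4 * M) with hs
  have hs0 : 0 < s := by positivity
  have hs1 : s ≤ 1 / 4 := by rw [hs, div_le_div_iff₀ (by positivity) (by norm_num)]; linarith
  set τ := (1 - s) ^ ((1 : ℝ) / n) with hτ
  have hn' : (1 : ℝ) ≤ n := by exact_mod_cast hn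
  have hτn : τ ^ n = 1 - s := by
    rw [hτ, one_div]; exact Real.rpow_inv_natCast_pow (by linarith) (by omega)
  have hτ1 : 3 / 4 ≤ τ := by
    have := Real.rpow_le_rpow_of_exponent_ge (x := 1 - s) (y := 1) (z := 1 / n) (by linarith)
      (by linarith) (by rw [div_le_one (by linarith)]; exact hn')
    rw [Real.rpow_one] at this
    linarith
  have hτ2 : τ < 1 := Real.rpow_lt_one (by linarith) (by linarith) (by positivity)
  set σ := 1 - τ with hσ
  have hσ0 : 0 < σ := by linarith
  set ρ := (1 + τ) / σ with hρ
  have hρ1 : 7 / σ ≤ 4 * ρ := by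
    rw [hρ, ← mul_div_assoc]
    gcongr
    linarith
  set K : ℝ := 2 ^ (2 * d + 1) * ρ ^ d with hK
  have hKlt : (6 / σ) ^ d < K := by
    have e : K = 2 * (4 * ρ) ^ d := by
      rw [hK, mul_pow, pow_succ, pow_mul]; norm_num; ring
    have h1 : (6 / σ) ^ d ≤ (4 * ρ) ^ d := by
      gcongr
      refine le_trans ?_ hρ1
      gcongr
      norm_num
    have h2 : 0 < (6 / σ) ^ d := by positivity
    rw [e]; linarith
  have hK0 : 0 < K := lt_trans (by positivity) hKlt
  have key : ∀ x ∈ B, f x ^ 2 ≤ K ^ 2 * (4 / (3 * m)) * I := by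
    intro x₀ hx₀
    rcases (hf0 x₀).eq_or_lt with h0 | h0
    · rw [← h0, zero_pow two_ne_zero]
      exact mul_nonneg (mul_nonneg (sq_nonneg K) (div_nonneg (by norm_num) (by linarith))) hI0
    set c := f x₀ / K with hc
    have hc0 : 0 < c := by positivity
    have hcK : f x₀ = K * c := by rw [hc]; field_simp
    have hAm : MeasurableSet {x | f x ≤ c} := measurableSet_le hfc.measurable measurable_const
    have hFle : volume (W ∩ {x | f x ≤ c}) ≤ ENNReal.ofReal s * volume B := by
      by_contra hcon
      have hcon := not_le.1 hcon
      have hr := rz_remez hn R P x₀ hx₀ σ s c hσ0 (by linarith) (by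
        rw [hσ, sub_sub_cancel, hτn]; ring)
        (hcon.trans_le (measure_mono fun x hx => ⟨hWB hx.1, hx.2⟩))
      rw [hd] at hr
      have : f x₀ < K * c := lt_of_le_of_lt hr (by gcongr)
      linarith
    have hFr : (volume (W ∩ {x | f x ≤ c})).toReal ≤ m / 4 := by
      have := ENNReal.toReal_mono (ENNReal.mul_ne_top ENNReal.ofReal_ne_top hBfin) hFle
      rw [ENNReal.toReal_mul, ENNReal.toReal_ofReal hs0.le, ← hM] at this
      refine this.trans (le_of_eq ?_)
      rw [hs]; field_simp
    have hsplit : m = (volume (W ∩ {x | f x ≤ c})).toReal + (volume (W \ {x | f x ≤ c})).toReal := by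
      rw [hm, ← measure_inter_add_sdiff (μ := volume) W hAm, ENNReal.toReal_add]
      · exact ne_top_of_le_ne_top hWfin (measure_mono Set.inter_subset_left)
      · exact ne_top_of_le_ne_top hWfin (measure_mono Set.sdiff_subset)
    have hGfin : volume (W \ {x | f x ≤ c}) ≠ ⊤ :=
      ne_top_of_le_ne_top hWfin (measure_mono Set.sdiff_subset)
    have hlow : c ^ 2 * (volume (W \ {x | f x ≤ c})).toReal ≤ I := by
      calc c ^ 2 * (volume (W \ {x | f x ≤ c})).toReal
          = ∫ x in W \ {x | f x ≤ c}, c ^ 2 := by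
            rw [setIntegral_const, smul_eq_mul, mul_comm]; rfl
        _ ≤ ∫ x in W \ {x | f x ≤ c}, f x ^ 2 := by
            apply setIntegral_mono_on (integrableOn_const hGfin)
              (hintW.mono_set Set.sdiff_subset) (hWm.diff hAm)
            intro x hx
            have : c < f x := not_le.1 hx.2
            gcongr
        _ ≤ I := setIntegral_mono_set hintW (Filter.Eventually.of_forall fun x => sq_nonneg _)
            (Filter.Eventually.of_forall fun x hx => hx.1)
    have h34 : c ^ 2 * (3 / 4 * m) ≤ I := by
      refine le_trans ?_ hlow
      gcongr
      linarith
    rw [hcK]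
    calc (K * c) ^ 2 = K ^ 2 * (4 / (3 * m)) * (c ^ 2 * (3 / 4 * m)) := by field_simp
      _ ≤ _ := by gcongr
  have hup : ∫ x in B, f x ^ 2 ≤ K ^ 2 * (4 * M / m / 3) * I := by
    calc ∫ x in B, f x ^ 2 ≤ ∫ x in B, K ^ 2 * (4 / (3 * m)) * I :=
          setIntegral_mono_on hintB (integrableOn_const hBfin) hBm key
      _ = M * (K ^ 2 * (4 / (3 * m)) * I) := by
          rw [setIntegral_const, smul_eq_mul, hM]; rfl
      _ = _ := by field_simp
  calc Real.sqrt (∫ x in B, f x ^ 2) ≤ Real.sqrt (K ^ 2 * (4 * M / m / 3) * I) :=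
        Real.sqrt_le_sqrt hup
    _ = K * (Real.sqrt (4 * M / m) / Real.sqrt 3) * Real.sqrt I := by
        rw [Real.sqrt_mul (by positivity), Real.sqrt_mul (by positivity), Real.sqrt_sq hK0.le,
          Real.sqrt_div (by positivity)]
    _ = _ := by rw [hK]; ring
end
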